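/- arXiv:2407.03002 — 2 statements merged into one kernel-verified Lean document; each statement's English description precedes it below -/
import Mathlib

section
/- For every integer n ≥ 1, the rational function h_n(v) has at most a simple pole at v = 1/n, and Res_{v=1/n} h_n(v) = (−1)^{n−1} r₂(n) / (n·16^n). -/
open Polynomial Filter Topology

/-- Derivative of a rational function. -/
noncomputable def ratDeriv (f : RatFunc ℚ) : RatFunc ℚ :=
  RatFunc.mk (Polynomial.derivative f.num * f.denom - f.num * Polynomial.derivative f.denom)
    (f.denom ^ 2)

/-- The number of representations of `n` as a sum of two squares of integers. -/
noncomputable def r2 (n : ℕ) : ℕ :=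
  Set.ncard {p : ℤ × ℤ | p.1 ^ 2 + p.2 ^ 2 = (n : ℤ)}


namespace R2Aux

lemma two_eq : (2 : PowerSeries ℚ) = PowerSeries.C 2 := (map_ofNat PowerSeries.C 2).symm

/-! ### Theta series -/

/-- Square roots of `n` in `ℤ`. -/
noncomputable def sqF (n : ℕ) : Finset ℤ := (Finset.Icc (-(n : ℤ)) n).filter (fun a => a ^ 2 = (n : ℤ))

lemma mem_sqF {n : ℕ} {a : ℤ} : a ∈ sqF n ↔ a ^ 2 = (n : ℤ) := by
  simp only [sqF, Finset.mem_filter, Finset.mem_Icc, and_iff_right_iff_imp]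
  intro h
  constructor <;> nlinarith [Int.natCast_nonneg n, sq_nonneg (a + 1), sq_nonneg (a - 1), abs_nonneg a, Int.le_self_sq a, Int.le_self_sq (-a)]

/-- Representations as a finset. -/
noncomputable def r2F (n : ℕ) : Finset (ℤ × ℤ) :=
  (Finset.Icc (-(n : ℤ)) n ×ˢ Finset.Icc (-(n : ℤ)) n).filter
    (fun p => p.1 ^ 2 + p.2 ^ 2 = (n : ℤ))

lemma mem_r2F {n : ℕ} {p : ℤ × ℤ} : p ∈ r2F n ↔ p.1 ^ 2 + p.2 ^ 2 = (n : ℤ) := by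
  obtain ⟨a, b⟩ := p
  simp only [r2F, Finset.mem_filter, Finset.mem_product, Finset.mem_Icc, and_iff_right_iff_imp]
  intro h
  refine ⟨⟨?_, ?_⟩, ?_, ?_⟩ <;>
    nlinarith [Int.le_self_sq a, Int.le_self_sq (-a), Int.le_self_sq b, Int.le_self_sq (-b),
      sq_nonneg a, sq_nonneg b]

lemma r2_eq (n : ℕ) : r2 n = (r2F n).card := by
  rw [r2, ← Set.ncard_coe_finset]
  congr 1
  ext p
  simp [mem_r2F]

/-- Coefficients of the theta series. -/
noncomputable def tc (n : ℕ) : ℚ := (sqF n).card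

lemma tc_conv (n : ℕ) : ∑ ij ∈ Finset.HasAntidiagonal.antidiagonal n, tc ij.1 * tc ij.2 = (r2 n : ℚ) := by
  rw [r2_eq]
  have key : (r2F n).card = ∑ ij ∈ Finset.HasAntidiagonal.antidiagonal n, (sqF ij.1 ×ˢ sqF ij.2).card := by
    rw [Finset.card_eq_sum_card_fiberwise
      (f := fun p : ℤ × ℤ => ((p.1 ^ 2).toNat, (p.2 ^ 2).toNat)) (t := Finset.HasAntidiagonal.antidiagonal n)]
    · refine Finset.sum_congr rfl fun ij hij => ?_
      congr 1
      ext p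
      obtain ⟨i, j⟩ := ij
      obtain ⟨a, b⟩ := p
      simp only [Finset.HasAntidiagonal.mem_antidiagonal] at hij
      simp only [Finset.mem_filter, mem_r2F, Finset.mem_product, mem_sqF, Prod.mk.injEq]
      have := sq_nonneg a
      have := sq_nonneg b
      constructor
      · rintro ⟨h1, h2, h3⟩; omega
      · rintro ⟨h1, h2⟩; omega
    · intro p hp
      simp only [Finset.mem_coe, mem_r2F] at hp
      simp only [Finset.mem_coe, Finset.HasAntidiagonal.mem_antidiagonal]
      have := sq_nonneg p.1
      have := sq_nonneg p.2
      omega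
  rw [key]
  push_cast
  refine Finset.sum_congr rfl fun ij _ => ?_
  simp [tc, Finset.card_product]

lemma r2_two_mul (k : ℕ) : r2 (2 * k) = r2 k := by
  rw [r2_eq, r2_eq]
  symm
  refine Finset.card_bij (fun p _ => (p.1 + p.2, p.1 - p.2)) ?_ ?_ ?_
  · intro p hp
    rw [mem_r2F] at hp ⊢
    push_cast
    rw [← hp]; ring
  · rintro ⟨a, b⟩ _ ⟨c, d⟩ _ h
    simp only [Prod.mk.injEq] at h ⊢
    omega
  · rintro ⟨a, b⟩ h
    rw [mem_r2F] at h
    push_cast at h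
    have hpar : Even (a + b) := by
      have h1 : Even (a ^ 2 + b ^ 2) := ⟨k, by linarith⟩
      simpa [Int.even_add, Int.even_pow] using h1
    obtain ⟨c, hc⟩ := hpar
    refine ⟨(c, a - c), ?_, ?_⟩
    · rw [mem_r2F]
      have : b = c + c - a := by linarith
      subst this
      simp only
      nlinarith
    · simp only [Prod.mk.injEq]; constructor <;> linarith

/-- theta_3. -/
noncomputable def th3 : PowerSeries ℚ := PowerSeries.mk tc
/-- theta_4. -/
noncomputable def th4 : PowerSeries ℚ := PowerSeries.mk fun n => (-1) ^ n * tc n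
/-- theta_3 squared. -/
noncomputable def A : PowerSeries ℚ := PowerSeries.mk fun n => (r2 n : ℚ)
/-- theta_4 squared. -/
noncomputable def B : PowerSeries ℚ := PowerSeries.mk fun n => (-1) ^ n * (r2 n : ℚ)

lemma th3_sq : th3 * th3 = A := by
  ext n
  simp [th3, A, PowerSeries.coeff_mul, tc_conv]

lemma th4_sq : th4 * th4 = B := by
  ext n
  simp only [th4, B, PowerSeries.coeff_mul, PowerSeries.coeff_mk]
  rw [← tc_conv, Finset.mul_sum]
  refine Finset.sum_congr rfl fun ij hij => ?_
  rw [Finset.HasAntidiagonal.mem_antidiagonal] at hij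
  rw [← hij, pow_add]; ring

/-- The doubling map. -/
noncomputable def sg : PowerSeries ℚ →ₐ[ℚ] PowerSeries ℚ := PowerSeries.expand 2 two_ne_zero

lemma coeff_sg (f : PowerSeries ℚ) (n : ℕ) :
    (sg f).coeff n = if 2 ∣ n then f.coeff (n / 2) else 0 := PowerSeries.coeff_expand _ _ _

lemma sg_A : 2 * sg A = A + B := by
  ext n
  rw [two_eq, PowerSeries.coeff_C_mul, coeff_sg]
  simp only [A, B, map_add, PowerSeries.coeff_mk]
  split_ifs with h
  · obtain ⟨k, rfl⟩ := h
    rw [r2_two_mul, Nat.mul_div_cancel_left _ two_pos]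
    simp; ring
  · have : Odd n := by rwa [← Nat.not_even_iff_odd, even_iff_two_dvd]
    rw [this.neg_one_pow]; ring

lemma th34 : th3 * th4 = sg B := by
  ext n
  rw [coeff_sg]
  simp only [th3, th4, B, PowerSeries.coeff_mul, PowerSeries.coeff_mk]
  split_ifs with h
  · obtain ⟨k, rfl⟩ := h
    rw [Nat.mul_div_cancel_left _ two_pos, ← r2_two_mul, ← tc_conv, Finset.mul_sum]
    refine Finset.sum_congr rfl fun ij hij => ?_
    obtain ⟨i, j⟩ := ij
    rw [Finset.HasAntidiagonal.mem_antidiagonal] at hij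
    simp only at hij ⊢
    by_cases hi : (sqF i) = ∅
    · simp [tc, hi]
    by_cases hj : (sqF j) = ∅
    · simp [tc, hj]
    obtain ⟨a, ha⟩ := Finset.nonempty_iff_ne_empty.mpr hi
    obtain ⟨b, hb⟩ := Finset.nonempty_iff_ne_empty.mpr hj
    rw [mem_sqF] at ha hb
    have hpar : (-1 : ℚ) ^ j = (-1) ^ k := by
      have : j % 2 = k % 2 := by
        have e : (i : ℤ) + j = 2 * k := by exact_mod_cast hij
        rcases Int.even_or_odd' a with ⟨c, rfl | rfl⟩ <;>
        rcases Int.even_or_odd' b with ⟨d, rfl | rfl⟩ <;> ring_nf at ha hb <;> omega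
      rw [neg_one_pow_eq_pow_mod_two, this, ← neg_one_pow_eq_pow_mod_two]
    rw [hpar]; ring
  · have hodd : Odd n := by rwa [← Nat.not_even_iff_odd, even_iff_two_dvd]
    have h1 : ∑ p ∈ Finset.HasAntidiagonal.antidiagonal n, tc p.1 * ((-1) ^ p.2 * tc p.2)
        = ∑ p ∈ Finset.HasAntidiagonal.antidiagonal n, -(tc p.1 * ((-1) ^ p.2 * tc p.2)) := by
      rw [← Finset.Nat.sum_antidiagonal_swap]
      refine Finset.sum_congr rfl fun ij hij => ?_
      rw [Finset.HasAntidiagonal.mem_antidiagonal] at hij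
      have : (-1 : ℚ) ^ ij.1 * (-1) ^ ij.2 = -1 := by
        rw [← pow_add, hij, hodd.neg_one_pow]
      have h3 : (-1 : ℚ) ^ ij.2 * (-1) ^ ij.2 = 1 := by
        rw [← mul_pow]; simp
      simp only [Prod.fst_swap, Prod.snd_swap]
      have h4 : (-1 : ℚ) ^ ij.1 = - (-1) ^ ij.2 := by
        linear_combination (-1) ^ ij.2 * this - (-1) ^ ij.1 * h3
      rw [h4]; ring
    rw [Finset.sum_neg_distrib] at h1
    linarith

lemma sg_B : sg B * sg B = A * B := by
  rw [← th34, ← th3_sq, ← th4_sq]; ring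

/-- Euler operator. -/
noncomputable def E (f : PowerSeries ℚ) : PowerSeries ℚ :=
  PowerSeries.X * PowerSeries.derivative ℚ f

lemma E_add (f g) : E (f + g) = E f + E g := by simp [E, mul_add]
lemma E_sub (f g) : E (f - g) = E f - E g := by simp [E, mul_sub]
lemma E_mul (f g) : E (f * g) = f * E g + g * E f := by
  simp [E, Derivation.leibniz]; ring
lemma E_C (a : ℚ) : E (PowerSeries.C a) = 0 := by simp [E]
lemma coeff_E (f : PowerSeries ℚ) (n : ℕ) : (E f).coeff n = n * f.coeff n := by
  cases n with
  | zero => simp [E]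
  | succ n => simp [E, PowerSeries.coeff_succ_X_mul, PowerSeries.coeff_derivative]; ring

lemma E_sg (f : PowerSeries ℚ) : E (sg f) = 2 * sg (E f) := by
  ext n
  rw [two_eq, PowerSeries.coeff_C_mul, coeff_E, coeff_sg, coeff_sg]
  split_ifs with h
  · obtain ⟨k, rfl⟩ := h
    rw [Nat.mul_div_cancel_left _ two_pos, coeff_E]; push_cast; ring
  · simp

lemma r2_zero : r2 0 = 1 := by
  rw [r2_eq]; decide
lemma r2_one : r2 1 = 4 := by
  rw [r2_eq]; decide

lemma coeff_A0 : A.coeff 0 = 1 := by simp [A, r2_zero]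
lemma coeff_B0 : B.coeff 0 = 1 := by simp [B, r2_zero]
lemma coeff_A1 : A.coeff 1 = 4 := by simp [A, r2_one]
lemma coeff_B1 : B.coeff 1 = -4 := by simp [B, r2_one]

lemma coeff_one_mul' (f g : PowerSeries ℚ) :
    (f * g).coeff 1 = f.coeff 0 * g.coeff 1 + f.coeff 1 * g.coeff 0 := by
  rw [PowerSeries.coeff_mul, show Finset.HasAntidiagonal.antidiagonal 1 = {(0, 1), (1, 0)} from rfl]
  simp

lemma coeff_zero_mul' (f g : PowerSeries ℚ) :
    (f * g).coeff 0 = f.coeff 0 * g.coeff 0 := by simp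

lemma order_unit {f : PowerSeries ℚ} (h : f.coeff 0 ≠ 0) : f.order = 0 := by
  have := (PowerSeries.order_eq_nat (φ := f) (n := 0)).2 ⟨h, by simp⟩
  simpa using this

lemma order_sg (f : PowerSeries ℚ) : (sg f).order = 2 * f.order := by
  rw [sg, PowerSeries.order_expand]; simp

/-- First identity. -/
lemma P_eq : 2 * (E A * B - A * E B) = A * B * (A ^ 2 - B ^ 2) := by
  set P := 2 * (E A * B - A * E B) - A * B * (A ^ 2 - B ^ 2) with hP
  have hA1 := sg_A
  have hB1 := sg_B
  have hA2 : 4 * sg (E A) = E A + E B := by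
    have := congrArg E hA1
    rw [E_add, E_mul, E_sg, two_eq, E_C, ← two_eq] at this
    linear_combination this
  have hB2 : 4 * (sg B * sg (E B)) = A * E B + B * E A := by
    have := congrArg E hB1
    rw [E_mul, E_mul, E_sg] at this
    linear_combination this
  have key : 8 * (sg B * sg P) = (A - B) * P := by
    have e : sg P = 2 * (sg (E A) * sg B - sg A * sg (E B))
        - sg A * sg B * (sg A ^ 2 - sg B ^ 2) := by
      simp only [hP, map_sub, map_mul, map_pow, map_ofNat]
    rw [e, hP]
    generalize sg A = a1 at *
    generalize sg (E A) = a2 at *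
    generalize sg (E B) = b2 at *
    generalize sg B = b1 at *
    linear_combination 4 * b1 ^ 2 * hA2 + 4 * (E A + E B) * hB1 - 8 * b1 * b2 * hA1
      - 2 * (A + B) * hB2 - 8 * a1 * (a1 ^ 2 - (b1 ^ 2 + A * B)) * hB1
      - A * B * (4 * a1 ^ 2 + 2 * a1 * (A + B) + (A + B) ^ 2) * hA1 + 4 * A ^ 2 * B ^ 2 * hA1
  have hP0 : P = 0 := by
    by_contra hne
    have ho := congrArg PowerSeries.order key
    have hAB : (A - B).order = 1 := by
      have := (PowerSeries.order_eq_nat (φ := A - B) (n := 1)).2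
        ⟨by rw [map_sub, coeff_A1, coeff_B1]; norm_num, fun i hi => by
          obtain rfl : i = 0 := by omega
          rw [map_sub, coeff_A0, coeff_B0, sub_self]⟩
      simpa using this
    have h8 : (8 : PowerSeries ℚ).order = 0 := by
      apply order_unit
      rw [show (8 : PowerSeries ℚ) = PowerSeries.C 8 from (map_ofNat PowerSeries.C 8).symm]
      simp
    have hB0 : B.order = 0 := order_unit (by rw [coeff_B0]; norm_num)
    rw [PowerSeries.order_mul, PowerSeries.order_mul, PowerSeries.order_mul, h8, order_sg, order_sg,
      hB0, hAB] at ho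
    have hfin : P.order ≠ ⊤ := by rwa [Ne, PowerSeries.order_eq_top]
    obtain ⟨k, hk⟩ := ENat.ne_top_iff_exists.mp hfin
    rw [← hk] at ho
    have hk1 : k = 1 := by
      have : ((0 + (2 * 0 + 2 * k) : ℕ) : ℕ∞) = ((1 + k : ℕ) : ℕ∞) := by
        push_cast; exact ho
      have := ENat.natCast_inj.mp this
      omega
    subst hk1
    have hne1 := ((PowerSeries.order_eq_nat (φ := P) (n := 1)).1 hk.symm).1
    apply hne1
    rw [hP, two_eq, map_sub, PowerSeries.coeff_C_mul, map_sub]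
    simp only [pow_two, coeff_one_mul', coeff_zero_mul', map_sub, coeff_E, coeff_A0, coeff_A1,
      coeff_B0, coeff_B1]
    norm_num
  exact sub_eq_zero.mp hP0

/-- Logarithmic derivative of `B`. -/
noncomputable def ell : PowerSeries ℚ := B⁻¹ * E B

lemma B_ne : B ≠ 0 := fun h => by
  have := coeff_B0; rw [h] at this; simp at this
lemma A_ne : A ≠ 0 := fun h => by
  have := coeff_A0; rw [h] at this; simp at this

lemma E_B : E B = B * ell := by
  rw [ell, ← mul_assoc, PowerSeries.mul_inv_cancel, one_mul]
  have := coeff_B0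
  rw [PowerSeries.coeff_zero_eq_constantCoeff_apply] at this
  rw [this]; norm_num

lemma E_A : 2 * E A = A * (2 * ell + (A ^ 2 - B ^ 2)) := by
  apply mul_left_cancel₀ B_ne
  linear_combination P_eq + 2 * A * E_B

lemma sg_B_ne : sg B ≠ 0 := fun h => by
  have := sg_B
  rw [h] at this
  simp only [mul_zero] at this
  rcases mul_eq_zero.mp this.symm with h | h
  exacts [A_ne h, B_ne h]

lemma E_num (n : ℕ) [n.AtLeastTwo] : E (OfNat.ofNat n) = 0 := by
  rw [← map_ofNat PowerSeries.C n, E_C]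

lemma sg_ell : 8 * sg ell = 4 * ell + (A ^ 2 - B ^ 2) := by
  have h1 := congrArg E sg_B
  rw [E_mul, E_mul, E_sg, E_B, map_mul] at h1
  apply mul_left_cancel₀ (mul_ne_zero A_ne B_ne)
  linear_combination 2 * h1 - 8 * sg ell * sg_B + B * E_A

lemma E_w : E (A ^ 2 - B ^ 2) = 2 * (A ^ 2 - B ^ 2) * ell + A ^ 2 * (A ^ 2 - B ^ 2) := by
  rw [E_sub, pow_two, pow_two, E_mul, E_mul]
  linear_combination A * E_A - 2 * B * E_B

lemma E_ell : 4 * E ell = 4 * ell ^ 2 - A ^ 2 * (A ^ 2 - B ^ 2) := by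
  set R := 4 * E ell - (4 * ell ^ 2 - A ^ 2 * (A ^ 2 - B ^ 2)) with hR
  have key : 4 * sg R = R := by
    have h1 := congrArg E sg_ell
    rw [E_mul, E_add, E_w, E_mul, E_num, E_num, E_sg] at h1
    have h2 : sg R = 4 * sg (E ell) - (4 * sg ell ^ 2 - sg A ^ 2 * (sg A ^ 2 - sg B ^ 2)) := by
      simp only [hR, map_sub, map_mul, map_pow, map_ofNat]
    have h16 : (16 : PowerSeries ℚ) ≠ 0 := by
      rw [show (16 : PowerSeries ℚ) = PowerSeries.C 16 from (map_ofNat PowerSeries.C 16).symm]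
      simp
    apply mul_left_cancel₀ h16
    rw [h2, hR]
    have hl := sg_ell
    have ha := sg_A
    have hb := sg_B
    generalize sg A = a1 at *
    generalize sg B = b1 at *
    generalize sg ell = l1 at *
    linear_combination 16 * h1 - 4 * (8 * l1 + (4 * ell + (A ^ 2 - B ^ 2))) * hl
      + 4 * (4 * a1 ^ 2 + (A + B) ^ 2) * (2 * a1 + (A + B)) * ha
      - 16 * (b1 * b1) * (2 * a1 + (A + B)) * ha - 16 * (A + B) ^ 2 * hb
  have h0 : ∀ n, R.coeff n = 0 := by
    intro n
    induction n using Nat.strong_induction_on with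
    | _ n ih =>
      have h := congrArg (PowerSeries.coeff n) key
      rw [show (4 : PowerSeries ℚ) = PowerSeries.C 4 from (map_ofNat PowerSeries.C 4).symm,
        PowerSeries.coeff_C_mul, coeff_sg] at h
      split_ifs at h with hd
      · rcases Nat.eq_zero_or_pos n with rfl | hn
        · simp only [Nat.zero_div] at h; linarith
        · rw [ih (n / 2) (by omega)] at h; linarith
      · linarith
  have : R = 0 := PowerSeries.ext fun n => by simpa using h0 n
  exact sub_eq_zero.mp this

/-- The elliptic modulus. -/
noncomputable def md : PowerSeries ℚ := 1 - B ^ 2 * (A⁻¹) ^ 2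

lemma A_inv : A * A⁻¹ = 1 := by
  apply PowerSeries.mul_inv_cancel
  have := coeff_A0
  rw [PowerSeries.coeff_zero_eq_constantCoeff_apply] at this
  rw [this]; norm_num

lemma A_md : A ^ 2 * md = A ^ 2 - B ^ 2 := by
  rw [md]
  linear_combination - B ^ 2 * (A * A⁻¹ + 1) * A_inv

lemma E_md : E md = B ^ 2 * md := by
  have h := congrArg E A_md
  rw [E_w, E_mul, pow_two, E_mul] at h
  apply mul_left_cancel₀ (pow_ne_zero 2 A_ne)
  linear_combination h - A * md * E_A + (2 * ell + A ^ 2 - B ^ 2) * (-1) * A_md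
    - B ^ 2 * A_md

lemma md_coeff0 : md.constantCoeff = 0 := by
  have h := congrArg (PowerSeries.coeff 0) A_md
  simp only [pow_two, coeff_zero_mul', map_sub, coeff_A0, coeff_B0] at h
  rw [← PowerSeries.coeff_zero_eq_constantCoeff_apply]
  linarith

lemma md_coeff1 : md.coeff 1 = 16 := by
  have h := congrArg (PowerSeries.coeff 1) A_md
  have h0 := md_coeff0
  rw [← PowerSeries.coeff_zero_eq_constantCoeff_apply] at h0
  simp only [pow_two, coeff_zero_mul', coeff_one_mul', map_sub, coeff_A0, coeff_B0, coeff_A1,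
    coeff_B1, h0] at h
  linarith

lemma md_unit : IsUnit (md.coeff 1) := by rw [md_coeff1]; norm_num

/-- The inverse of the modulus series. -/
noncomputable def nm : PowerSeries ℚ := md.substInvOfIsUnit md_unit

lemma nm_subst : PowerSeries.HasSubst nm := PowerSeries.HasSubst.substInvOfIsUnit _ _
lemma nm_coeff0 : nm.constantCoeff = 0 := PowerSeries.constantCoeff_substInvOfIsUnit _ _
lemma nm_coeff1 : nm.coeff 1 = 1 / 16 := by
  rw [nm, PowerSeries.coeff_one_substInvOfIsUnit]
  have : (md_unit.unit : ℚ) = 16 := by rw [IsUnit.unit_spec, md_coeff1]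
  rw [Units.val_inv_eq_inv_val, this]; norm_num

/-- Substituting the nome. -/
noncomputable def sb (f : PowerSeries ℚ) : PowerSeries ℚ := f.subst nm

lemma sb_mul (f g) : sb (f * g) = sb f * sb g := PowerSeries.subst_mul nm_subst _ _
lemma sb_sub (f g) : sb (f - g) = sb f - sb g := PowerSeries.subst_sub nm_subst _ _
lemma sb_X : sb PowerSeries.X = nm := PowerSeries.subst_X nm_subst
lemma sb_md : sb md = PowerSeries.X := PowerSeries.subst_substInvOfIsUnit_right _ md_coeff0 _
lemma sb_pow (f) (n : ℕ) : sb (f ^ n) = sb f ^ n := PowerSeries.subst_pow nm_subst _ _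
lemma sb_num (n : ℕ) [n.AtLeastTwo] : sb (OfNat.ofNat n) = OfNat.ofNat n := by
  rw [sb, ← PowerSeries.coe_substAlgHom nm_subst, map_ofNat]
lemma sb_one : sb 1 = 1 := by
  rw [sb, ← PowerSeries.coe_substAlgHom nm_subst, map_one]

lemma nm_E_sb (f) : nm * E (sb f) = sb (E f) * E nm := by
  rw [E, sb, PowerSeries.derivative_subst nm_subst]
  rw [E, sb_mul, sb_X, sb, E]
  ring

lemma nm_ne : nm ≠ 0 := fun h => by
  have := nm_coeff1; rw [h] at this; norm_num at this

lemma E_X : E PowerSeries.X = PowerSeries.X := by simp [E]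

lemma E_nm : sb B ^ 2 * E nm = nm := by
  have h := nm_E_sb md
  rw [sb_md, E_md, sb_mul, sb_md, sb_pow, E_X] at h
  apply mul_left_cancel₀ (PowerSeries.X_ne_zero (R := ℚ))
  linear_combination -h

lemma E_sb (f) : sb B ^ 2 * E (sb f) = sb (E f) := by
  apply mul_left_cancel₀ nm_ne
  linear_combination sb B ^ 2 * nm_E_sb f + sb (E f) * E_nm

/-- the series a -/
noncomputable def as : PowerSeries ℚ := sb (A⁻¹) ^ 2
/-- the series c -/
noncomputable def cs : PowerSeries ℚ := as * sb ell
/-- the series y -/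
noncomputable def ys : PowerSeries ℚ := sb B

lemma ys_as : ys ^ 2 * as = 1 - PowerSeries.X := by
  have h := congrArg sb A_md
  rw [sb_mul, sb_md, sb_sub, sb_pow, sb_pow] at h
  have h2 := congrArg sb A_inv
  rw [sb_mul, sb_one] at h2
  rw [ys, as]
  linear_combination (1 - PowerSeries.X) * (sb A * sb A⁻¹ + 1) * h2 + sb A⁻¹ ^ 2 * h

lemma as_A : as * sb A ^ 2 = 1 := by
  have h2 := congrArg sb A_inv
  rw [sb_mul, sb_one] at h2
  rw [as]
  linear_combination (sb A * sb A⁻¹ + 1) * h2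

lemma E_ys : (1 - PowerSeries.X) * E ys = cs * ys := by
  have h := E_sb B
  rw [E_B, sb_mul] at h
  rw [← ys_as, cs, ys]
  linear_combination as * h

lemma E_nm' : (1 - PowerSeries.X) * E nm = as * nm := by
  rw [← ys_as, ys]
  linear_combination as * E_nm

lemma ys_E_as : ys ^ 2 * E as = - (PowerSeries.X + 2 * cs) := by
  have h := congrArg E ys_as
  have h1 : E 1 = 0 := by simp [E]
  rw [E_mul, pow_two, E_mul, E_sub, h1, E_X] at h
  have h2 := E_sb B
  rw [E_B, sb_mul] at h2
  have h3 : ys * E ys = sb ell := by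
    apply mul_left_cancel₀ (show ys ≠ 0 from fun h0 => by
      have := ys_as
      rw [h0] at this
      have := congrArg PowerSeries.constantCoeff this
      simp at this)
    rw [ys]; linear_combination h2
  rw [cs]
  linear_combination h - 2 * as * h3

lemma E_as : (1 - PowerSeries.X) * E as = - as * (PowerSeries.X + 2 * cs) := by
  rw [← ys_as]
  linear_combination as * ys_E_as

lemma E_cs : 4 * ((1 - PowerSeries.X) * E cs) =
    - (4 * cs ^ 2 + 4 * cs * PowerSeries.X + PowerSeries.X) := by
  have h := congrArg sb E_ell
  have hm := congrArg sb A_md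
  rw [sb_mul, sb_md, sb_pow] at hm
  rw [sb_mul, sb_sub, sb_mul, sb_mul, sb_num, sb_pow, sb_pow, ← hm, ← E_sb ell] at h
  have ha := as_A
  have h1 := ys_E_as
  rw [← ys_as]
  have h2 : E cs = as * E (sb ell) + sb ell * E as := by rw [cs, E_mul]
  rw [h2]
  have h3 : cs = as * sb ell := rfl
  rw [ys] at *
  rw [h3] at h1 ⊢
  linear_combination as ^ 2 * h + 4 * as * sb ell * h1
    - PowerSeries.X * (as * sb A ^ 2 + 1) * ha

/-! ### The two variable series -/

/-- The Euler operator in q. -/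
noncomputable def EE (f : PowerSeries ℚ[X]) : PowerSeries ℚ[X] :=
  PowerSeries.X * PowerSeries.derivative ℚ[X] f

lemma EE_add (f g) : EE (f + g) = EE f + EE g := by simp [EE, mul_add]
lemma EE_sub (f g) : EE (f - g) = EE f - EE g := by simp [EE, mul_sub]
lemma EE_mul (f g) : EE (f * g) = f * EE g + g * EE f := by
  simp [EE, Derivation.leibniz]; ring
lemma EE_C (a : ℚ[X]) : EE (PowerSeries.C a) = 0 := by simp [EE]
lemma EE_one : EE 1 = 0 := by simp [EE]
lemma coeff_EE (f : PowerSeries ℚ[X]) (n : ℕ) : (EE f).coeff n = n * f.coeff n := by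
  cases n with
  | zero => simp [EE]
  | succ n => simp [EE, PowerSeries.coeff_succ_X_mul, PowerSeries.coeff_derivative]; ring

/-- The derivative in s. -/
noncomputable def dd (f : PowerSeries ℚ[X]) : PowerSeries ℚ[X] :=
  PowerSeries.mk fun n => Polynomial.derivative (f.coeff n)

lemma coeff_dd (f : PowerSeries ℚ[X]) (n : ℕ) :
    (dd f).coeff n = Polynomial.derivative (f.coeff n) := by simp [dd]
lemma dd_add (f g) : dd (f + g) = dd f + dd g := by ext1 n; simp [coeff_dd]
lemma dd_sub (f g) : dd (f - g) = dd f - dd g := by ext1 n; simp [coeff_dd]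
lemma dd_mul (f g) : dd (f * g) = f * dd g + g * dd f := by
  ext1 n
  rw [mul_comm g]
  simp only [coeff_dd, PowerSeries.coeff_mul, map_add, Polynomial.derivative_sum,
    Polynomial.derivative_mul, Finset.sum_add_distrib]
  rw [add_comm]
lemma dd_C (a : ℚ[X]) : dd (PowerSeries.C a) = PowerSeries.C (Polynomial.derivative a) := by
  ext1 n; simp only [coeff_dd, PowerSeries.coeff_C]; split_ifs <;> simp
lemma dd_one : dd 1 = 0 := by
  have := dd_C 1
  simpa using this

lemma dd_EE (f) : dd (EE f) = EE (dd f) := by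
  ext1 n
  simp [coeff_dd, coeff_EE]

/-- Inclusion of series in q. -/
noncomputable def io : PowerSeries ℚ →+* PowerSeries ℚ[X] := PowerSeries.map Polynomial.C

lemma EE_io (f) : EE (io f) = io (E f) := by
  ext1 n
  simp [coeff_EE, io, coeff_E]
lemma dd_io (f) : dd (io f) = 0 := by
  ext1 n
  simp [coeff_dd, io]
lemma io_X : io PowerSeries.X = PowerSeries.X := by simp [io]

/-- the variable s -/
noncomputable def sv : PowerSeries ℚ[X] := PowerSeries.C Polynomial.X
lemma EE_sv : EE sv = 0 := EE_C _
lemma dd_sv : dd sv = 1 := by rw [sv, dd_C]; simp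

lemma sb_coeff0 (f : PowerSeries ℚ) : (sb f).constantCoeff = f.constantCoeff := by
  have h : f = PowerSeries.C f.constantCoeff + PowerSeries.X * (PowerSeries.mk fun n => f.coeff (n + 1)) := by
    ext n
    cases n <;> simp [PowerSeries.coeff_succ_X_mul, PowerSeries.coeff_C]
  conv_lhs => rw [h]
  rw [sb, PowerSeries.subst_add nm_subst, ← sb, ← sb, sb_mul, sb_X, map_add, map_mul, nm_coeff0,
    zero_mul, add_zero, sb]
  erw [PowerSeries.subst_C]
  exact PowerSeries.constantCoeff_C _

lemma ys_coeff0 : ys.constantCoeff = 1 := by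
  rw [ys, sb_coeff0, ← PowerSeries.coeff_zero_eq_constantCoeff_apply, coeff_B0]

lemma as_coeff0 : as.constantCoeff = 1 := by
  have := congrArg PowerSeries.constantCoeff ys_as
  simpa [ys_coeff0] using this

lemma cs_coeff0 : cs.constantCoeff = 0 := by
  have := congrArg PowerSeries.constantCoeff E_ys
  simpa [ys_coeff0, E] using this.symm

/-- u = 1 + c s -/
noncomputable def uu : PowerSeries ℚ[X] := 1 + io cs * sv
/-- its inverse -/
noncomputable def WW : PowerSeries ℚ[X] := PowerSeries.invOfUnit uu 1

lemma constantCoeff_io (f) : (io f).constantCoeff = Polynomial.C f.constantCoeff := by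
  rw [← PowerSeries.coeff_zero_eq_constantCoeff_apply, ← PowerSeries.coeff_zero_eq_constantCoeff_apply, io,
    PowerSeries.coeff_map]

lemma uu_coeff0 : uu.constantCoeff = 1 := by
  simp [uu, constantCoeff_io, cs_coeff0]

lemma uW : uu * WW = 1 := PowerSeries.mul_invOfUnit _ _ (by simp [uu_coeff0])

lemma W_coeff0 : WW.constantCoeff = 1 := by
  have := congrArg PowerSeries.constantCoeff uW
  simpa [uu_coeff0] using this

lemma dd_W : dd WW = - io cs * WW ^ 2 := by
  have h := congrArg dd uW
  rw [dd_mul, dd_one, uu, dd_add, dd_mul, dd_one, dd_io, dd_sv, ← uu] at h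
  linear_combination WW * h - dd WW * uW

lemma EE_W : EE WW = - sv * io (E cs) * WW ^ 2 := by
  have h := congrArg EE uW
  rw [EE_mul, EE_one, uu, EE_add, EE_mul, EE_one, EE_io, EE_sv, ← uu] at h
  linear_combination WW * h - EE WW * uW

/-- exponent -/
noncomputable def TT : PowerSeries ℚ[X] := io as * sv * WW
/-- exponent shifted -/
noncomputable def ww : PowerSeries ℚ[X] := TT - sv

lemma ww_coeff0 : ww.constantCoeff = 0 := by
  simp [ww, TT, constantCoeff_io, as_coeff0, W_coeff0, sv]

lemma ww_subst : PowerSeries.HasSubst ww := PowerSeries.HasSubst.of_constantCoeff_zero' ww_coeff0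

/-- The exponential factor. -/
noncomputable def VV : PowerSeries ℚ[X] := (PowerSeries.exp ℚ[X]).subst ww

lemma EE_V : EE VV = VV * EE ww := by
  rw [EE, VV, PowerSeries.derivative_subst ww_subst, PowerSeries.derivative_exp, EE]
  ring

lemma V_coeff0 : VV.constantCoeff = 1 := by
  rw [VV, ← PowerSeries.coeff_zero_eq_constantCoeff_apply, PowerSeries.coeff_subst' ww_subst,
    finsum_eq_single _ 0]
  · simp
  · intro n hn
    simp [ww_coeff0, hn]

lemma uniq {R g : PowerSeries ℚ[X]} (h : EE R = R * EE g) (h0 : R.constantCoeff = 0) : R = 0 := by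
  have : ∀ n, R.coeff n = 0 := by
    intro n
    induction n using Nat.strong_induction_on with
    | _ n ih =>
      rcases Nat.eq_zero_or_pos n with rfl | hn
      · simpa using h0
      have h1 := congrArg (PowerSeries.coeff n) h
      rw [coeff_EE, PowerSeries.coeff_mul, Finset.sum_eq_zero] at h1
      · have : (n : ℚ[X]) ≠ 0 := by exact_mod_cast hn.ne'
        exact (mul_eq_zero.mp h1).resolve_left this
      · rintro ⟨i, j⟩ hij
        rw [Finset.HasAntidiagonal.mem_antidiagonal] at hij
        simp only at hij ⊢
        rcases Nat.eq_zero_or_pos j with rfl | hj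
        · simp [coeff_EE]
        · rw [ih i (by omega), zero_mul]
  ext1 n
  simpa using this n

lemma dd_V : dd VV = VV * dd ww := by
  rw [← sub_eq_zero]
  apply uniq (g := ww)
  · rw [EE_sub, ← dd_EE, EE_V, dd_mul, EE_mul, EE_V, dd_EE]
    ring
  · rw [map_sub, map_mul, ← PowerSeries.coeff_zero_eq_constantCoeff_apply,
      ← PowerSeries.coeff_zero_eq_constantCoeff_apply,
      ← PowerSeries.coeff_zero_eq_constantCoeff_apply (φ := dd ww), coeff_dd, coeff_dd,
      PowerSeries.coeff_zero_eq_constantCoeff_apply,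
      PowerSeries.coeff_zero_eq_constantCoeff_apply, V_coeff0, ww_coeff0]
    simp

/-- The family of solutions. -/
noncomputable def YY (k : ℕ) : PowerSeries ℚ[X] := (io nm * VV) ^ k * (io ys⁻¹ * WW)

section
local notation "q" => (PowerSeries.X : PowerSeries ℚ[X])

lemma hE_as : (1 - q) * io (E as) = - io as * (q + 2 * io cs) := by
  have := congrArg io E_as
  simpa only [map_mul, map_sub, map_add, map_one, map_neg, map_pow, map_ofNat, io_X] using this
lemma hE_cs : 4 * ((1 - q) * io (E cs)) = -(4 * io cs ^ 2 + 4 * io cs * q + q) := by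
  have := congrArg io E_cs
  simpa only [map_mul, map_sub, map_add, map_one, map_neg, map_pow, map_ofNat, io_X] using this
lemma hE_nm : (1 - q) * io (E nm) = io as * io nm := by
  have := congrArg io E_nm'
  simpa only [map_mul, map_sub, map_add, map_one, map_neg, map_pow, map_ofNat, io_X] using this
lemma ys_inv : ys * ys⁻¹ = 1 :=
  PowerSeries.mul_inv_cancel _ (by rw [ys_coeff0]; norm_num)
lemma hE_ysinv : (1 - q) * io (E ys⁻¹) = - io cs * io ys⁻¹ := by
  have h := congrArg E ys_inv
  have h1 : E 1 = 0 := by simp [E]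
  rw [E_mul, h1] at h
  have h2 : (1 - PowerSeries.X) * E ys⁻¹ = - cs * ys⁻¹ := by
    linear_combination (1 - PowerSeries.X) * ys⁻¹ * h - (ys⁻¹) ^ 2 * E_ys
      - (1 - PowerSeries.X) * E ys⁻¹ * ys_inv - cs * ys⁻¹ * ys_inv
  have := congrArg io h2
  simpa only [map_mul, map_sub, map_add, map_one, map_neg, map_pow, map_ofNat, io_X] using this

lemma nabla_M : (4 - 4 * q * sv + q * sv ^ 2) * (dd (io nm * VV) + io nm * VV) =
    4 * (1 - q) * EE (io nm * VV) := by
  have hd : dd ww = io as * WW ^ 2 - 1 := by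
    rw [ww, dd_sub, dd_sv, TT, dd_mul, dd_mul, dd_io, dd_sv, dd_W]
    have := uW
    rw [uu] at this
    linear_combination io as * WW * (-1) * this
  have he : EE ww = sv * WW * io (E as) - io as * sv ^ 2 * io (E cs) * WW ^ 2 := by
    rw [ww, EE_sub, EE_sv, TT, EE_mul, EE_mul, EE_io, EE_sv, EE_W]
    ring
  rw [dd_mul, EE_mul, dd_io, EE_io, dd_V, EE_V, hd, he]
  have h := uW
  rw [uu] at h
  have h1 := hE_as
  have h2 := hE_cs
  have h3 := hE_nm
  generalize io as = a at *
  generalize io cs = c at *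
  generalize io nm = n at *
  generalize WW = W at *
  generalize sv = s at *
  generalize VV = V at *
  linear_combination n * V * (4 * a * ((1 + c * s) * W + 1) * h - 4 * a * s * W * (q + 2 * c) * h)
    - 4 * V * h3 - 4 * n * V * s * W * h1 + n * V * a * s ^ 2 * W ^ 2 * h2

lemma nabla_0 : (4 - 4 * q * sv + q * sv ^ 2) * dd (YY 0) =
    4 * (1 - q) * EE (YY 0) - q * sv * YY 0 := by
  rw [YY, pow_zero, one_mul, dd_mul, EE_mul, dd_io, EE_io, dd_W, EE_W]
  have h := uW
  rw [uu] at h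
  have h2 := hE_cs
  have h3 := hE_ysinv
  generalize io cs = c at *
  generalize io ys⁻¹ = b at *
  generalize WW = W at *
  generalize sv = s at *
  linear_combination - b * W * (4 * c + q * s) * h - 4 * W * h3 + b * s * W ^ 2 * h2

lemma nabla (k : ℕ) : (4 - 4 * q * sv + q * sv ^ 2) * (dd (YY k) + k * YY k) =
    4 * (1 - q) * EE (YY k) - q * sv * YY k := by
  induction k with
  | zero => simpa using nabla_0
  | succ k ih =>
    have : YY (k + 1) = (io nm * VV) * YY k := by simp only [YY]; ring
    rw [this, dd_mul, EE_mul]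
    push_cast
    linear_combination (io nm * VV) * ih + YY k * nabla_M

/-- Coefficients of the solutions. -/
noncomputable def yc (k n : ℕ) : ℚ[X] := (YY k).coeff n

lemma yc_rec (k n : ℕ) :
    4 * (derivative (yc k (n + 1)) + (k : ℚ[X]) * yc k (n + 1))
      - 4 * Polynomial.X * (derivative (yc k n) + (k : ℚ[X]) * yc k n)
      + Polynomial.X ^ 2 * (derivative (yc k n) + (k : ℚ[X]) * yc k n)
    = 4 * ((n : ℚ[X]) + 1) * yc k (n + 1) - 4 * (n : ℚ[X]) * yc k n - Polynomial.X * yc k n := by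
  have h := congrArg (PowerSeries.coeff (n + 1)) (nabla k)
  set Z := dd (YY k) + k * YY k with hZ
  have hc : ∀ m, Z.coeff m = derivative (yc k m) + (k : ℚ[X]) * yc k m := by
    intro m
    rw [hZ, map_add, coeff_dd, yc, ← map_natCast (PowerSeries.C (R := ℚ[X])) k,
      PowerSeries.coeff_C_mul]
  have e1 : (4 - 4 * q * sv + q * sv ^ 2) * Z = PowerSeries.C 4 * Z
      - q * (PowerSeries.C (4 * Polynomial.X) * Z) + q * (PowerSeries.C (Polynomial.X ^ 2) * Z) := by
    simp only [sv, map_mul, map_pow, map_ofNat]; ring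
  have e2 : 4 * (1 - q) * EE (YY k) - q * sv * YY k = PowerSeries.C 4 * EE (YY k)
      - q * (PowerSeries.C 4 * EE (YY k)) - q * (PowerSeries.C Polynomial.X * YY k) := by
    simp only [sv, map_mul, map_pow, map_ofNat]; ring
  rw [e1, e2] at h
  simp only [map_add, map_sub, PowerSeries.coeff_succ_X_mul, PowerSeries.coeff_C_mul, hc,
    coeff_EE] at h
  rw [← yc, ← yc] at h
  push_cast at h
  linear_combination h

lemma nm_dvd : ∃ n1 : PowerSeries ℚ, nm = PowerSeries.X * n1 ∧ n1.constantCoeff = 1 / 16 := by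
  obtain ⟨n1, h⟩ := PowerSeries.X_dvd_iff.mpr nm_coeff0
  refine ⟨n1, h, ?_⟩
  have := nm_coeff1
  rw [h, show (1 : ℕ) = 0 + 1 from rfl, PowerSeries.coeff_succ_X_mul] at this
  simpa using this

lemma ysinv_coeff0 : (ys⁻¹).constantCoeff = 1 := by
  have := congrArg PowerSeries.constantCoeff ys_inv
  simpa [ys_coeff0] using this

lemma yc_lt {k n : ℕ} (h : n < k) : yc k n = 0 := by
  obtain ⟨n1, h1, _⟩ := nm_dvd
  have h1' : io nm = q * io n1 := by rw [h1, map_mul, io_X]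
  rw [yc, YY, h1', mul_assoc q, mul_pow, mul_assoc (q ^ k), PowerSeries.coeff_X_pow_mul',
    if_neg (by omega)]

lemma yc_self (k : ℕ) : yc k k = Polynomial.C ((1 / 16) ^ k) := by
  obtain ⟨n1, h1, h2⟩ := nm_dvd
  have h1' : io nm = q * io n1 := by rw [h1, map_mul, io_X]
  rw [yc, YY, h1', mul_assoc q, mul_pow, mul_assoc (q ^ k), PowerSeries.coeff_X_pow_mul',
    if_pos le_rfl, Nat.sub_self, PowerSeries.coeff_zero_eq_constantCoeff_apply]
  simp [constantCoeff_io, V_coeff0, W_coeff0, h2, ys_coeff0, Polynomial.C_pow]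
  rw [← Polynomial.C_pow, inv_pow]

end

/-- evaluation at s = 0 -/
noncomputable def ev : PowerSeries ℚ[X] →+* PowerSeries ℚ :=
  PowerSeries.map (Polynomial.evalRingHom 0)

lemma ev_io (f) : ev (io f) = f := by ext n; simp [ev, io]
lemma ev_sv : ev sv = 0 := by simp [ev, sv]
lemma ev_W : ev WW = 1 := by
  have := congrArg ev uW
  simpa [uu, ev_sv] using this
lemma ev_V : ev VV = 1 := by
  have hw : ev ww = 0 := by simp [ww, TT, ev_sv]
  have hev : ∀ f, ev (EE f) = E (ev f) := by
    intro f; ext n; simp [ev, coeff_EE, coeff_E]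
  have h := congrArg ev EE_V
  rw [map_mul, hev, hev, hw] at h
  have h0 : E 0 = 0 := by simp [E]
  rw [h0, mul_zero] at h
  ext n
  cases n with
  | zero =>
    have : (ev VV).coeff 0 = 1 := by
      rw [ev, PowerSeries.coeff_map, PowerSeries.coeff_zero_eq_constantCoeff_apply, V_coeff0]; simp
    simpa using this
  | succ n =>
    have := congrArg (PowerSeries.coeff (n + 1)) h
    rw [coeff_E, map_zero] at this
    have h2 : ((n + 1 : ℕ) : ℚ) ≠ 0 := by positivity
    rw [(mul_eq_zero.mp this).resolve_left h2]
    simp [PowerSeries.coeff_one]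

lemma yc_eval (k n : ℕ) : (yc k n).eval 0 = (nm ^ k * ys⁻¹).coeff n := by
  have : ev (YY k) = nm ^ k * ys⁻¹ := by
    simp [YY, ev_io, ev_V, ev_W]
  rw [← this]; simp [ev, yc]

lemma sum_yc (n : ℕ) (hn : 1 ≤ n) :
    ∑ k ∈ Finset.range (n + 1), (-1) ^ k * (r2 k : ℚ) * (yc k n).eval 0 = 0 := by
  simp only [yc_eval]
  set S := ∑ k ∈ Finset.range (n + 1), PowerSeries.C ((-1) ^ k * (r2 k : ℚ)) * nm ^ k with hS
  have hd : PowerSeries.X ^ (n + 1) ∣ ys - S := by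
    rw [PowerSeries.X_pow_dvd_iff]
    intro m hm
    have hz : ∀ k, m < k → (nm ^ k).coeff m = 0 := by
      intro k hk
      obtain ⟨n1, h1, _⟩ := nm_dvd
      rw [h1, mul_pow, PowerSeries.coeff_X_pow_mul', if_neg (by omega)]
    rw [map_sub, ys, sb, PowerSeries.coeff_subst' nm_subst,
      finsum_eq_sum_of_support_subset (s := Finset.range (n + 1)), hS, map_sum]
    · rw [← Finset.sum_sub_distrib]
      apply Finset.sum_eq_zero
      intro k _
      rw [PowerSeries.coeff_C_mul]
      simp only [B, PowerSeries.coeff_mk, smul_eq_mul, sub_self]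
    · intro k hk
      simp only [Finset.coe_range, Set.mem_Iio]
      by_contra hlt
      apply hk
      simp only
      rw [hz k (by omega), smul_zero]
  have h1 : (S * ys⁻¹).coeff n = 0 := by
    obtain ⟨g, hg⟩ := hd
    have : S * ys⁻¹ = 1 - PowerSeries.X ^ (n + 1) * (g * ys⁻¹) := by
      linear_combination ys_inv - ys⁻¹ * hg
    rw [this, map_sub, PowerSeries.coeff_X_pow_mul', if_neg (by omega), PowerSeries.coeff_one,
      if_neg (by omega), sub_zero]
  rw [hS, Finset.sum_mul, map_sum] at h1
  rw [← h1]
  refine Finset.sum_congr rfl fun k _ => ?_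
  rw [mul_assoc (PowerSeries.C _), PowerSeries.coeff_C_mul]

/-! ### Rational functions -/

lemma ratDeriv_aux (f : RatFunc ℚ) (p d : ℚ[X]) (hd : d ≠ 0)
    (h : f.num * d = p * f.denom) :
    (derivative f.num * f.denom - f.num * derivative f.denom) * d ^ 2 =
      (derivative p * d - p * derivative d) * f.denom ^ 2 := by
  have h' := congrArg derivative h
  rw [derivative_mul, derivative_mul] at h'
  generalize f.num = a at *
  generalize f.denom = b at *
  generalize derivative a = a' at *
  generalize derivative b = b' at *
  generalize derivative p = p' at *
  generalize derivative d = d' at *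
  linear_combination (d * b) * h' - (d * b' + d' * b) * h

lemma ratDeriv_div (p d : ℚ[X]) (hd : d ≠ 0) :
    ratDeriv (algebraMap _ (RatFunc ℚ) p / algebraMap _ _ d) =
      algebraMap _ _ (derivative p * d - p * derivative d) / algebraMap _ _ (d ^ 2) := by
  obtain ⟨f, hf⟩ : ∃ f, f = algebraMap _ (RatFunc ℚ) p / algebraMap _ _ d := ⟨_, rfl⟩
  have h := ratDeriv_aux f p d hd ((RatFunc.num_mul_eq_mul_denom_iff (x := f) hd).mpr hf)
  rw [← hf, ratDeriv, RatFunc.mk_eq_div,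
    div_eq_div_iff (RatFunc.algebraMap_ne_zero (pow_ne_zero 2 f.denom_ne_zero))
    (RatFunc.algebraMap_ne_zero (pow_ne_zero 2 hd)), ← map_mul, ← map_mul, h]

lemma smul_eq (a : ℚ) (f : RatFunc ℚ) : a • f = (a : RatFunc ℚ) * f := by
  rw [RatFunc.smul_eq_C_mul]
  congr 1
  exact map_ratCast RatFunc.C a

lemma poly_C (a : ℚ) : algebraMap ℚ[X] (RatFunc ℚ) (Polynomial.C a) = (a : RatFunc ℚ) := by
  rw [RatFunc.algebraMap_C]
  exact map_ratCast RatFunc.C a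

lemma ratDeriv_add (f g : RatFunc ℚ) : ratDeriv (f + g) = ratDeriv f + ratDeriv g := by
  have hf := RatFunc.algebraMap_ne_zero f.denom_ne_zero
  have hg := RatFunc.algebraMap_ne_zero g.denom_ne_zero
  conv_lhs => rw [← RatFunc.num_div_denom f, ← RatFunc.num_div_denom g, div_add_div _ _ hf hg,
    ← map_mul, ← map_mul, ← map_mul, ← map_add,
    ratDeriv_div _ _ (mul_ne_zero f.denom_ne_zero g.denom_ne_zero)]
  rw [ratDeriv, ratDeriv, RatFunc.mk_eq_div, RatFunc.mk_eq_div]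
  simp only [map_mul, map_add, map_sub, map_pow, derivative_mul]
  field_simp
  ring

lemma ratDeriv_mul (f g : RatFunc ℚ) : ratDeriv (f * g) = f * ratDeriv g + g * ratDeriv f := by
  have hf := RatFunc.algebraMap_ne_zero f.denom_ne_zero
  have hg := RatFunc.algebraMap_ne_zero g.denom_ne_zero
  have h1 : f * g = algebraMap _ _ (f.num * g.num) / algebraMap _ _ (f.denom * g.denom) := by
    conv_lhs => rw [← RatFunc.num_div_denom f, ← RatFunc.num_div_denom g]
    rw [map_mul, map_mul, div_mul_div_comm]
  have h2 : f * ratDeriv g + g * ratDeriv f =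
      algebraMap _ _ f.num / algebraMap _ _ f.denom * ratDeriv g
      + algebraMap _ _ g.num / algebraMap _ _ g.denom * ratDeriv f := by
    rw [RatFunc.num_div_denom f, RatFunc.num_div_denom g]
  rw [h1, h2, ratDeriv_div _ _ (mul_ne_zero f.denom_ne_zero g.denom_ne_zero),
    ratDeriv, ratDeriv, RatFunc.mk_eq_div, RatFunc.mk_eq_div]
  simp only [map_mul, map_sub, map_pow, derivative_mul, map_add]
  field_simp
  ring

lemma ratDeriv_poly (p : ℚ[X]) :
    ratDeriv (algebraMap _ (RatFunc ℚ) p) = algebraMap _ _ (derivative p) := by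
  have := ratDeriv_div p 1 one_ne_zero
  simpa using this

lemma ratDeriv_rat (a : ℚ) : ratDeriv (a : RatFunc ℚ) = 0 := by
  rw [← poly_C, ratDeriv_poly]
  simp

/-- The derivation `-v d/dv`. -/
noncomputable def DD : RatFunc ℚ →+ RatFunc ℚ :=
  AddMonoidHom.mk' (fun f => -(RatFunc.X * ratDeriv f)) (fun f g => by rw [ratDeriv_add]; ring)

lemma DD_apply (f) : DD f = -(RatFunc.X * ratDeriv f) := rfl

lemma DD_mul (f g : RatFunc ℚ) : DD (f * g) = f * DD g + g * DD f := by
  simp only [DD_apply, ratDeriv_mul]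
  ring

lemma DD_rat (a : ℚ) : DD (a : RatFunc ℚ) = 0 := by
  rw [DD_apply, ratDeriv_rat, mul_zero, neg_zero]

lemma DD_rat_mul (a : ℚ) (f : RatFunc ℚ) : DD (a * f) = a * DD f := by
  rw [DD_mul, DD_rat, mul_zero, add_zero]

lemma DD_nat (a : ℕ) : DD (a : RatFunc ℚ) = 0 := by
  have := DD_rat (a : ℚ)
  rwa [Rat.cast_natCast] at this

lemma DD_inv (f : RatFunc ℚ) (hf : f ≠ 0) : DD f⁻¹ = - (f⁻¹) ^ 2 * DD f := by
  have h1 : f * f⁻¹ = 1 := mul_inv_cancel₀ hf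
  have h := congrArg DD h1
  have h0 := DD_nat 1
  rw [Nat.cast_one] at h0
  rw [h0, DD_mul] at h
  linear_combination f⁻¹ * h - DD f⁻¹ * h1

lemma DD_pow (f : RatFunc ℚ) (n : ℕ) : DD (f ^ (n + 1)) = (n + 1) * f ^ n * DD f := by
  induction n with
  | zero => simp
  | succ n ih =>
    rw [pow_succ, DD_mul, ih]
    push_cast
    ring

/-- The variable `u = 1/v`. -/
noncomputable def U : RatFunc ℚ := RatFunc.X⁻¹

lemma DD_X : DD RatFunc.X = - RatFunc.X := by
  rw [DD_apply, ← RatFunc.algebraMap_X, ratDeriv_poly]; simp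

lemma X_U : RatFunc.X * U = 1 := mul_inv_cancel₀ RatFunc.X_ne_zero
lemma U_ne : U ≠ 0 := inv_ne_zero RatFunc.X_ne_zero

lemma DD_U : DD U = U := by
  rw [U, DD_inv _ RatFunc.X_ne_zero, DD_X]
  have := RatFunc.X_ne_zero (K := ℚ)
  field_simp

lemma U_sub_ne (k : ℕ) : U - (k : RatFunc ℚ) ≠ 0 := by
  intro h
  have h1 : (k : RatFunc ℚ) * RatFunc.X = 1 := by
    linear_combination X_U - RatFunc.X * h
  rw [← RatFunc.algebraMap_X, ← map_natCast (algebraMap ℚ[X] (RatFunc ℚ)), ← map_mul,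
    ← map_one (algebraMap ℚ[X] (RatFunc ℚ))] at h1
  have := congrArg (Polynomial.eval 0) (RatFunc.algebraMap_injective ℚ h1)
  simp at this

/-- The Laplace type transform. -/
noncomputable def LL (k : ℕ) : ℚ[X] →+ RatFunc ℚ :=
  AddMonoidHom.mk' (fun P => P.sum fun j a =>
    (a : RatFunc ℚ) * ((j.factorial : RatFunc ℚ) / (U - k) ^ (j + 1))) (fun P R => by
      refine Polynomial.sum_add_index P R _ (by simp) ?_
      intro j a b
      push_cast
      ring)

lemma LL_monomial (k j : ℕ) (a : ℚ) :
    LL k (monomial j a) = (a : RatFunc ℚ) * ((j.factorial : RatFunc ℚ) / (U - k) ^ (j + 1)) := by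
  rw [LL, AddMonoidHom.mk'_apply, Polynomial.sum_monomial_index _ _ (by simp)]

lemma LL_C (k : ℕ) (a : ℚ) : LL k (C a) = (a : RatFunc ℚ) * (1 / (U - k)) := by
  rw [← Polynomial.monomial_zero_left, LL_monomial]; simp

lemma LL_C_mul (k : ℕ) (a : ℚ) (P : ℚ[X]) : LL k (C a * P) = (a : RatFunc ℚ) * LL k P := by
  induction P using Polynomial.induction_on' with
  | add p r hp hr => rw [mul_add, map_add, map_add, hp, hr, mul_add]
  | monomial j b =>
    rw [Polynomial.C_mul_monomial, LL_monomial, LL_monomial]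
    push_cast
    ring

lemma LL_natCast_mul (k m : ℕ) (P : ℚ[X]) :
    LL k ((m : ℚ[X]) * P) = (m : RatFunc ℚ) * LL k P := by
  rw [← nsmul_eq_mul, map_nsmul, nsmul_eq_mul]

lemma U_LL (k : ℕ) (P : ℚ[X]) :
    U * LL k P = LL k (derivative P + (k : ℚ[X]) * P) + ((P.eval 0 : ℚ) : RatFunc ℚ) := by
  induction P using Polynomial.induction_on' with
  | add p r hp hr =>
    rw [map_add, mul_add, hp, hr, derivative_add, eval_add, Rat.cast_add]
    rw [show derivative p + derivative r + (k : ℚ[X]) * (p + r) = (derivative p + (k : ℚ[X]) * p)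
      + (derivative r + (k : ℚ[X]) * r) by ring,
      map_add (LL k) (derivative p + (k : ℚ[X]) * p)]
    ring
  | monomial j a =>
    have hk := U_sub_ne k
    rw [map_add, LL_natCast_mul, LL_monomial, derivative_monomial, LL_monomial]
    cases j with
    | zero =>
      simp only [Polynomial.eval_monomial]
      push_cast
      field_simp
      simp
      ring
    | succ j =>
      simp only [Polynomial.eval_monomial, Nat.add_sub_cancel, Nat.factorial_succ]
      push_cast
      field_simp
      simp
      ring

lemma DD_LL (k : ℕ) (P : ℚ[X]) : DD (LL k P) = - (U * LL k (Polynomial.X * P)) := by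
  induction P using Polynomial.induction_on' with
  | add p r hp hr => rw [map_add, map_add, hp, hr, mul_add, map_add]; ring
  | monomial j a =>
    have hk := U_sub_ne k
    rw [X_mul_monomial, LL_monomial, LL_monomial, DD_rat_mul, div_eq_mul_inv, DD_mul, DD_inv _ (pow_ne_zero _ hk), DD_pow, map_sub,
      DD_U, DD_nat, DD_nat, Nat.factorial_succ]
    push_cast
    field_simp
    simp
    ring

lemma DD2_LL (k : ℕ) (P : ℚ[X]) : DD (DD (LL k P)) =
    U * LL k (Polynomial.X * (derivative (Polynomial.X * P) + (k : ℚ[X]) * (Polynomial.X * P))) := by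
  rw [DD_LL, U_LL, map_neg, map_add, DD_LL, DD_rat]
  simp

/-- the sign weights -/
noncomputable def ep (k : ℕ) : ℚ := (-1) ^ k * (r2 k : ℚ)

/-- The solution, up to a factor. -/
noncomputable def gg (n : ℕ) : RatFunc ℚ := ∑ k ∈ Finset.range (n + 1), (ep k : RatFunc ℚ) * LL k (yc k n)

lemma gg_ext (n : ℕ) : gg n = ∑ k ∈ Finset.range (n + 2), (ep k : RatFunc ℚ) * LL k (yc k n) := by
  rw [Finset.sum_range_succ, yc_lt (Nat.lt_succ_self n), map_zero, mul_zero, add_zero, gg]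

lemma LL_step (k n : ℕ) :
    U * (U - ((n + 1 : ℕ) : RatFunc ℚ)) * LL k (yc k (n + 1))
      + U * (((n + 1 : ℕ) : RatFunc ℚ) * LL k (yc k n) + DD (LL k (yc k n)))
      + ((1 / 4 : ℚ) : RatFunc ℚ) * DD (DD (LL k (yc k n))) = U * ((((yc k (n + 1)).eval 0 : ℚ) : RatFunc ℚ)) := by
  rw [DD2_LL, DD_LL, U_LL k (Polynomial.X * yc k n)]
  have h1 := U_LL k (yc k (n + 1))
  set Y1 := yc k (n + 1) with hY1
  set Y := yc k n with hY
  have h2 : LL k (derivative Y1 + (k : ℚ[X]) * Y1) - ((n + 1 : ℕ) : RatFunc ℚ) * LL k Y1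
    + ((n + 1 : ℕ) : RatFunc ℚ) * LL k Y
    - LL k (derivative (Polynomial.X * Y) + (k : ℚ[X]) * (Polynomial.X * Y))
    + ((1 / 4 : ℚ) : RatFunc ℚ) * LL k (Polynomial.X * (derivative (Polynomial.X * Y) + (k : ℚ[X]) * (Polynomial.X * Y)))
    = 0 := by
    rw [← LL_natCast_mul, ← LL_natCast_mul, ← LL_C_mul, ← map_sub, ← map_add, ← map_sub, ← map_add]
    convert map_zero (LL k) using 2
    have h := yc_rec k n
    rw [← hY1, ← hY] at h
    rw [derivative_mul, derivative_X]
    have h4 : Polynomial.C (1 / 4 : ℚ) * 4 = 1 := by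
      rw [← map_ofNat Polynomial.C 4, ← map_mul]; norm_num
    push_cast
    generalize Polynomial.C (1 / 4 : ℚ) = c at *
    generalize derivative Y1 = Y1' at *
    generalize derivative Y = Y' at *
    linear_combination c * h - (Y1' + k * Y1 - (n + 1) * Y1 + (n + 1) * Y - Y - Polynomial.X * (Y' + k * Y)) * h4
  rw [eval_mul, eval_X, zero_mul, Rat.cast_zero, add_zero]
  linear_combination U * h1 + U * h2

lemma gg_rec (n : ℕ) :
    U * (U - ((n + 1 : ℕ) : RatFunc ℚ)) * gg (n + 1)
      + U * (((n + 1 : ℕ) : RatFunc ℚ) * gg n + DD (gg n))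
      + ((1 / 4 : ℚ) : RatFunc ℚ) * DD (DD (gg n)) = 0 := by
  have h0 : ∑ k ∈ Finset.range (n + 2),
    (ep k : RatFunc ℚ) * (U * ((((yc k (n + 1)).eval 0 : ℚ) : RatFunc ℚ))) = 0 := by
    have := sum_yc (n + 1) (by omega)
    simp_rw [mul_left_comm _ U]
    rw [← Finset.mul_sum]
    simp_rw [← Rat.cast_mul, ← Rat.cast_sum]
    simp only [ep]
    rw [this, Rat.cast_zero, mul_zero]
  rw [← h0, gg_ext n, gg]
  simp only [map_sum, Finset.mul_sum, DD_rat_mul, ← Finset.sum_add_distrib]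
  refine Finset.sum_congr rfl fun k _ => ?_
  rw [← LL_step]
  ring

lemma h_eq (h : ℕ → RatFunc ℚ)
    (h0 : h 0 = 1)
    (hrec : ∀ n : ℕ, 1 ≤ n →
      h n / RatFunc.X - (n : ℚ) • h n + ((n : ℚ) - 1) • h (n - 1)
        - RatFunc.X * ratDeriv (h (n - 1))
        + (1/4 : ℚ) •
          (RatFunc.X * ratDeriv (RatFunc.X * ratDeriv (RatFunc.X * h (n - 1)))) = 0)
    (n : ℕ) : h n = U * gg n := by
  induction n with
  | zero =>
    rw [h0, gg, Finset.sum_range_one, yc_self, LL_C, ep, r2_zero]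
    have := U_ne
    simp [this]
  | succ n ih =>
    have h1 := hrec (n + 1) (by omega)
    rw [Nat.add_sub_cancel, ih] at h1
    have e1 : RatFunc.X * ratDeriv (U * gg n) = - (U * gg n + U * DD (gg n)) := by
      have : DD (U * gg n) = _ := DD_apply (U * gg n)
      rw [DD_mul, DD_U] at this
      linear_combination this
    have e2 : RatFunc.X * ratDeriv (RatFunc.X * ratDeriv (RatFunc.X * (U * gg n)))
        = DD (DD (gg n)) := by
      rw [← mul_assoc, X_U, one_mul, DD_apply (DD _), DD_apply (gg n)]
      have : ratDeriv (-(RatFunc.X * ratDeriv (gg n))) = - ratDeriv (RatFunc.X * ratDeriv (gg n)) := by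
        have := ratDeriv_mul ((-1 : ℚ) : RatFunc ℚ) (RatFunc.X * ratDeriv (gg n))
        rw [ratDeriv_rat] at this
        simpa using this
      rw [this]; ring
    rw [e1, e2] at h1
    have h2 := gg_rec n
    have hne := U_sub_ne (n + 1)
    apply mul_left_cancel₀ hne
    rw [div_eq_mul_inv, ← U] at h1
    rw [smul_eq, smul_eq, smul_eq] at h1
    push_cast at h1 h2 ⊢
    linear_combination h1 - h2

/-! ### Values at a point -/

/-- `f` is regular at `c` with value `r`. -/
def Reg (c : ℚ) (f : RatFunc ℚ) (r : ℚ) : Prop :=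
  ∃ p d : ℚ[X], d.eval c ≠ 0 ∧ f = algebraMap _ _ p / algebraMap _ _ d ∧ p.eval c / d.eval c = r

lemma ne_of_eval {c : ℚ} {d : ℚ[X]} (h : d.eval c ≠ 0) : algebraMap _ (RatFunc ℚ) d ≠ 0 := by
  apply RatFunc.algebraMap_ne_zero
  rintro rfl
  simp at h

lemma Reg.add {c f g r s} (hf : Reg c f r) (hg : Reg c g s) : Reg c (f + g) (r + s) := by
  obtain ⟨p, d, hd, rfl, rfl⟩ := hf
  obtain ⟨p', d', hd', rfl, rfl⟩ := hg
  refine ⟨p * d' + d * p', d * d', by simp [hd, hd'], ?_, ?_⟩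
  · rw [div_add_div _ _ (ne_of_eval hd) (ne_of_eval hd')]; simp
  · rw [div_add_div _ _ hd hd']; simp

lemma Reg.mul {c f g r s} (hf : Reg c f r) (hg : Reg c g s) : Reg c (f * g) (r * s) := by
  obtain ⟨p, d, hd, rfl, rfl⟩ := hf
  obtain ⟨p', d', hd', rfl, rfl⟩ := hg
  refine ⟨p * p', d * d', by simp [hd, hd'], ?_, ?_⟩
  · rw [div_mul_div_comm]; simp
  · rw [div_mul_div_comm]; simp

lemma Reg.inv {c f r} (hf : Reg c f r) (hr : r ≠ 0) : Reg c f⁻¹ r⁻¹ := by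
  obtain ⟨p, d, hd, rfl, rfl⟩ := hf
  refine ⟨d, p, ?_, ?_, ?_⟩
  · intro h; rw [h] at hr; simp at hr
  · rw [inv_div]
  · rw [inv_div]

lemma Reg.poly (c : ℚ) (p : ℚ[X]) : Reg c (algebraMap _ _ p) (p.eval c) :=
  ⟨p, 1, by simp, by simp, by simp⟩

lemma Reg.rat (c a : ℚ) : Reg c (a : RatFunc ℚ) a := by
  have := Reg.poly c (Polynomial.C a)
  rw [eval_C] at this
  rwa [poly_C] at this

lemma Reg.smul {c f r} (hf : Reg c f r) (a : ℚ) : Reg c ((a : RatFunc ℚ) * f) (a * r) :=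
  (Reg.rat c a).mul hf

lemma Reg.pow {c f r} (hf : Reg c f r) (m : ℕ) : Reg c (f ^ m) (r ^ m) := by
  induction m with
  | zero => simpa using Reg.rat c 1
  | succ m ih => rw [pow_succ, pow_succ]; exact ih.mul hf

lemma Reg.sum {c : ℚ} (m : ℕ) (f : ℕ → RatFunc ℚ) (hf : ∀ k < m, ∃ r, Reg c (f k) r) :
    ∃ r, Reg c (∑ k ∈ Finset.range m, f k) r := by
  induction m with
  | zero => exact ⟨0, by simpa using Reg.rat c 0⟩
  | succ m ih =>
    obtain ⟨r, hr⟩ := ih fun k hk => hf k (by omega)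
    obtain ⟨s, hs⟩ := hf m (by omega)
    exact ⟨r + s, by rw [Finset.sum_range_succ]; exact hr.add hs⟩

lemma Reg.U {c : ℚ} (hc : c ≠ 0) : Reg c U c⁻¹ := by
  have := Reg.poly c Polynomial.X
  rw [eval_X, RatFunc.algebraMap_X] at this
  exact this.inv hc

lemma Reg.LL {c : ℚ} (hc : c ≠ 0) (k : ℕ) (hk : c⁻¹ ≠ k) (P : ℚ[X]) :
    ∃ r, Reg c (LL k P) r := by
  induction P using Polynomial.induction_on' with
  | add p r hp hr =>
    obtain ⟨x, hx⟩ := hp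
    obtain ⟨y, hy⟩ := hr
    exact ⟨x + y, by rw [map_add]; exact hx.add hy⟩
  | monomial j a =>
    have h1 : Reg c (R2Aux.U - (k : RatFunc ℚ)) (c⁻¹ + (-k)) := by
      have := (Reg.U hc).add (Reg.rat c (-k))
      convert this using 1
      push_cast; ring
    have h2 := (h1.pow (j + 1)).inv (pow_ne_zero _ (by rw [← sub_eq_add_neg]; exact sub_ne_zero.mpr hk))
    have h3 := ((Reg.rat c (j.factorial)).mul h2).smul a
    rw [LL_monomial, div_eq_mul_inv]
    refine ⟨a * (j.factorial * ((c⁻¹ + -k) ^ (j + 1))⁻¹), ?_⟩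
    simpa only [Rat.cast_natCast] using h3

lemma h_reg (n : ℕ) (hn : 1 ≤ n) :
    Reg (1 / n) ((RatFunc.X - ((1 / n : ℚ) : RatFunc ℚ)) * (U * gg n))
      ((-1) ^ (n - 1) * (r2 n : ℚ) / (n * 16 ^ n)) := by
  have hn0 : (n : ℚ) ≠ 0 := by positivity
  have hn1 : (n : RatFunc ℚ) ≠ 0 := by exact_mod_cast hn0
  have hc : (1 / n : ℚ) ≠ 0 := by positivity
  rw [gg, Finset.sum_range_succ]
  obtain ⟨r, hr⟩ := Reg.sum (c := 1 / n) n (fun k => (ep k : RatFunc ℚ) * LL k (yc k n)) (by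
    intro k hk
    obtain ⟨r, hr⟩ := Reg.LL hc k (by
      rw [one_div, inv_inv]; exact_mod_cast hk.ne') (yc k n)
    exact ⟨_, hr.smul _⟩)
  have h1 : Reg (1 / n) (RatFunc.X - ((1 / n : ℚ) : RatFunc ℚ)) 0 := by
    have := (Reg.poly (1 / n) Polynomial.X).add (Reg.rat (1 / n) (-(1 / n)))
    rw [eval_X, add_neg_cancel, RatFunc.algebraMap_X] at this
    convert this using 1
    push_cast; ring
  have h2 := h1.mul ((Reg.U hc).mul hr)
  have h3 : (RatFunc.X - ((1 / n : ℚ) : RatFunc ℚ)) * (U * ((ep n : RatFunc ℚ) * LL n (yc n n))) =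
      ((-(1 / n) * (ep n * (1 / 16) ^ n) : ℚ) : RatFunc ℚ) := by
    rw [yc_self, LL_C]
    have := U_sub_ne n
    have hx := X_U
    push_cast
    field_simp
    linear_combination (n : RatFunc ℚ) * ep n * hx
  have h4 := h2.add (Reg.rat (1 / n) (-(1 / n) * (ep n * (1 / 16) ^ n)))
  rw [← h3] at h4
  convert h4 using 1
  · ring
  · rw [ep]
    obtain ⟨m, rfl⟩ : ∃ m, n = m + 1 := ⟨n - 1, by omega⟩
    rw [Nat.add_sub_cancel]
    simp only [one_div, inv_pow]
    field_simp
    ring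

lemma eval_div' (p d : ℚ[X]) (v : ℝ) (hd : d.eval₂ (algebraMap ℚ ℝ) v ≠ 0) :
    RatFunc.eval (algebraMap ℚ ℝ) v (algebraMap _ _ p / algebraMap _ _ d) =
      p.eval₂ (algebraMap ℚ ℝ) v / d.eval₂ (algebraMap ℚ ℝ) v := by
  have hd0 : d ≠ 0 := by rintro rfl; simp at hd
  set f := algebraMap _ (RatFunc ℚ) p / algebraMap _ _ d with hf
  have h := (RatFunc.num_mul_eq_mul_denom_iff (x := f) hd0).mpr hf
  obtain ⟨e, he⟩ := (RatFunc.denom_dvd (x := f) hd0).mpr ⟨p, hf⟩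
  have hd' : f.denom.eval₂ (algebraMap ℚ ℝ) v ≠ 0 := by
    intro h0
    rw [he, eval₂_mul, h0, zero_mul] at hd
    exact hd rfl
  have h' := congrArg (Polynomial.eval₂ (algebraMap ℚ ℝ) v) h
  rw [eval₂_mul, eval₂_mul] at h'
  rw [RatFunc.eval, div_eq_div_iff hd' hd, h']

lemma tendsto_of_reg {c r : ℚ} {f : RatFunc ℚ}
    (hf : Reg c ((RatFunc.X - (c : RatFunc ℚ)) * f) r) :
    Tendsto (fun v : ℝ => (v - c) * RatFunc.eval (algebraMap ℚ ℝ) v f) (𝓝[≠] (c : ℝ))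
      (𝓝 (r : ℝ)) := by
  obtain ⟨p, d, hd, h, rfl⟩ := hf
  have hev : ∀ P : ℚ[X], P.eval₂ (algebraMap ℚ ℝ) (c : ℝ) = ((P.eval c : ℚ) : ℝ) := by
    intro P
    have := Polynomial.eval₂_at_apply (p := P) (algebraMap ℚ ℝ) c
    simpa using this
  have hcont : ∀ P : ℚ[X], Continuous fun v : ℝ => P.eval₂ (algebraMap ℚ ℝ) v := by
    intro P
    simp_rw [← Polynomial.eval_map]
    exact (P.map (algebraMap ℚ ℝ)).continuous
  have hlin : RatFunc.X - (c : RatFunc ℚ) =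
      algebraMap _ (RatFunc ℚ) (Polynomial.X - Polynomial.C c) := by
    rw [map_sub, poly_C, RatFunc.algebraMap_X]
  have hf : f = algebraMap _ _ p / algebraMap _ _ ((Polynomial.X - Polynomial.C c) * d) := by
    have h1 : algebraMap _ (RatFunc ℚ) (Polynomial.X - Polynomial.C c) ≠ 0 :=
      RatFunc.algebraMap_ne_zero (Polynomial.X_sub_C_ne_zero c)
    rw [map_mul, mul_comm, ← div_div, ← h, hlin, mul_div_cancel_left₀ _ h1]
  have hd' : d.eval₂ (algebraMap ℚ ℝ) (c : ℝ) ≠ 0 := by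
    rw [hev]; exact_mod_cast hd
  have hlim : Tendsto (fun v : ℝ => p.eval₂ (algebraMap ℚ ℝ) v / d.eval₂ (algebraMap ℚ ℝ) v)
      (𝓝[≠] (c : ℝ)) (𝓝 ((p.eval c / d.eval c : ℚ) : ℝ)) := by
    have := ((hcont p).tendsto (c : ℝ)).div ((hcont d).tendsto (c : ℝ)) hd'
    rw [hev, hev] at this
    push_cast
    exact this.mono_left nhdsWithin_le_nhds
  refine hlim.congr' ?_
  have hne : ∀ᶠ v in 𝓝[≠] (c : ℝ), d.eval₂ (algebraMap ℚ ℝ) v ≠ 0 :=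
    ((hcont d).continuousAt.eventually_ne hd').filter_mono nhdsWithin_le_nhds
  filter_upwards [hne, self_mem_nhdsWithin] with v hv hvc
  have hvc' : v - (c : ℝ) ≠ 0 := sub_ne_zero.mpr hvc
  have hl : (Polynomial.X - Polynomial.C c).eval₂ (algebraMap ℚ ℝ) v = v - c := by simp
  rw [hf, eval_div' _ _ _ (by rw [eval₂_mul, hl]; exact mul_ne_zero hvc' hv), eval₂_mul, hl]
  field_simp

end R2Aux

/-- For every `n ≥ 1`, the rational function `h n` has at most a simple pole at `v = 1/n`
and `Res_{v = 1/n} h n = (-1)^(n-1) * r₂(n) / (n * 16^n)`. -/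
theorem residue_of_h_at_one_over_n
    (h : ℕ → RatFunc ℚ)
    (h0 : h 0 = 1)
    (hrec : ∀ n : ℕ, 1 ≤ n →
      h n / RatFunc.X - (n : ℚ) • h n + ((n : ℚ) - 1) • h (n - 1)
        - RatFunc.X * ratDeriv (h (n - 1))
        + (1/4 : ℚ) •
          (RatFunc.X * ratDeriv (RatFunc.X * ratDeriv (RatFunc.X * h (n - 1)))) = 0)
    (n : ℕ) (hn : 1 ≤ n) :
    Tendsto (fun v : ℝ => (v - 1 / n) * RatFunc.eval (algebraMap ℚ ℝ) v (h n))
      (𝓝[≠] ((1 : ℝ) / n))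
      (𝓝 ((-1 : ℝ) ^ (n - 1) * (r2 n) / (n * 16 ^ n))) := by
  have h1 := R2Aux.h_reg n hn
  rw [← R2Aux.h_eq h h0 hrec n] at h1
  have h2 := R2Aux.tendsto_of_reg h1
  push_cast at h2
  exact h2
end

section
/- For every integer n ≥ 1, the rational function h_n(v) has a pole at v = 1/n if and only if n is a sum of two squares of integers, i.e. there exist a,b∈ℤ with n = a² + b². -/
open Polynomial

/-- The derivation `p d/dp` on power series. -/
noncomputable def Dp (R : Type*) [CommRing R] [Algebra ℚ R] :
    Derivation ℚ (PowerSeries R) (PowerSeries R) :=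
  ((PowerSeries.X : PowerSeries R) • PowerSeries.derivative R).restrictScalars ℚ

lemma coeff_Dp {R : Type*} [CommRing R] [Algebra ℚ R] (f : PowerSeries R) (n : ℕ) :
    PowerSeries.coeff n (Dp R f) = n * PowerSeries.coeff n f := by
  have h : Dp R f = PowerSeries.X * PowerSeries.derivative R f := rfl
  rw [h]
  cases n with
  | zero => simp
  | succ n =>
    rw [PowerSeries.coeff_succ_X_mul, PowerSeries.coeff_derivative]
    push_cast; ring

lemma Dp_mul {R : Type*} [CommRing R] [Algebra ℚ R] (f g : PowerSeries R) :
    Dp R (f * g) = Dp R f * g + f * Dp R g := by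
  rw [Derivation.leibniz]; simp only [smul_eq_mul]; ring

/-- integer points on the circle of squared radius `n` -/
noncomputable def circ (n : ℕ) : Finset (ℤ × ℤ) :=
  ((Finset.Icc (-(n:ℤ)) n) ×ˢ (Finset.Icc (-(n:ℤ)) n)).filter (fun x => x.1 ^ 2 + x.2 ^ 2 = n)

lemma mem_circ (n : ℕ) (x : ℤ × ℤ) : x ∈ circ n ↔ x.1 ^ 2 + x.2 ^ 2 = n := by
  unfold circ
  simp only [Finset.mem_filter, Finset.mem_product, Finset.mem_Icc, and_iff_right_iff_imp]
  intro h
  refine ⟨⟨?_, ?_⟩, ⟨?_, ?_⟩⟩ <;> nlinarith [sq_nonneg x.1, sq_nonneg x.2, sq_nonneg (x.1 - 1), sq_nonneg (x.1+1), sq_nonneg (x.2-1), sq_nonneg (x.2+1), Int.le_self_sq x.1, Int.le_self_sq x.2, Int.le_self_sq (-x.1), Int.le_self_sq (-x.2)]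

/-- square roots of `n` -/
noncomputable def rts (n : ℕ) : Finset ℤ := (Finset.Icc (-(n:ℤ)) n).filter (fun x => x ^ 2 = n)

lemma mem_rts (n : ℕ) (x : ℤ) : x ∈ rts n ↔ x ^ 2 = n := by
  unfold rts
  simp only [Finset.mem_filter, Finset.mem_Icc, and_iff_right_iff_imp]
  intro h
  refine ⟨?_, ?_⟩ <;> nlinarith [Int.le_self_sq x, Int.le_self_sq (-x)]

/-- weighted theta series -/
noncomputable def thetaW (w : ℤ → ℚ) : PowerSeries ℚ := PowerSeries.mk fun n => ∑ i ∈ rts n, w i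

lemma coeff_thetaW_mul (w w' : ℤ → ℚ) (n : ℕ) :
    PowerSeries.coeff n (thetaW w * thetaW w') = ∑ x ∈ circ n, w x.1 * w' x.2 := by
  rw [PowerSeries.coeff_mul]
  rw [← Finset.sum_fiberwise_of_maps_to (s := circ n) (t := Finset.HasAntidiagonal.antidiagonal n)
    (g := fun x => (x.1.natAbs ^ 2, x.2.natAbs ^ 2))]
  · refine Finset.sum_congr rfl fun kl hkl => ?_
    rw [Finset.HasAntidiagonal.mem_antidiagonal] at hkl
    simp only [thetaW, PowerSeries.coeff_mk]
    rw [Finset.sum_mul_sum, ← Finset.sum_product']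
    refine Finset.sum_congr ?_ fun _ _ => rfl
    ext ⟨i, j⟩
    simp only [Finset.mem_product, mem_rts, Finset.mem_filter, mem_circ, Prod.ext_iff]
    rw [← hkl]
    zify
    simp only [sq_abs]
    constructor
    · rintro ⟨h1, h2⟩; exact ⟨by rw [h1, h2], h1, h2⟩
    · rintro ⟨_, h1, h2⟩; exact ⟨h1, h2⟩
  · intro x hx
    rw [mem_circ] at hx
    rw [Finset.HasAntidiagonal.mem_antidiagonal]
    zify
    simpa only [sq_abs] using hx

noncomputable def sg (i : ℤ) : ℚ := if Even i then 1 else -1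

lemma sg_mul (i j : ℤ) : sg i * sg j = sg (i + j) := by
  unfold sg
  by_cases hi : Even i <;> by_cases hj : Even j <;> simp [hi, hj, Int.even_add]

lemma sg_sq_add (i j : ℤ) : sg (i + j) = sg (i ^ 2 + j ^ 2) := by
  unfold sg
  simp [Int.even_add, Int.even_pow]

noncomputable def th3 : PowerSeries ℚ := thetaW fun _ => 1
noncomputable def th4 : PowerSeries ℚ := thetaW sg
noncomputable def tha : PowerSeries ℚ := th3 * th3
noncomputable def thy : PowerSeries ℚ := th4 * th4

lemma coeff_tha (n : ℕ) : PowerSeries.coeff n tha = (circ n).card := by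
  unfold tha th3; rw [coeff_thetaW_mul]; simp

lemma coeff_thy (n : ℕ) : PowerSeries.coeff n thy = sg n * (circ n).card := by
  unfold thy th4; rw [coeff_thetaW_mul]
  rw [Finset.sum_congr rfl (g := fun _ => sg n)]
  · simp [mul_comm]
  · intro x hx
    rw [mem_circ] at hx
    rw [sg_mul, sg_sq_add, hx]

lemma circ_two_mul {M : Type*} [AddCommMonoid M] (n : ℕ) (f : ℤ × ℤ → M) :
    ∑ x ∈ circ (2 * n), f x = ∑ x ∈ circ n, f (x.1 + x.2, x.1 - x.2) := by
  symm
  refine Finset.sum_bij' (fun x _ => (x.1 + x.2, x.1 - x.2))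
    (fun x _ => ((x.1 + x.2) / 2, (x.1 - x.2) / 2)) ?_ ?_ ?_ ?_ ?_
  · intro x hx
    rw [mem_circ] at hx ⊢
    push_cast; rw [← hx]; ring
  · intro x hx
    rw [mem_circ] at hx ⊢
    have hev : Even (x.1 + x.2) := by
      have : Even (x.1 ^ 2 + x.2 ^ 2) := by rw [hx]; simp
      simpa [Int.even_add, Int.even_pow] using this
    obtain ⟨k, hk⟩ := hev
    have h1 : (x.1 + x.2) / 2 = k := by omega
    have h2 : (x.1 - x.2) / 2 = k - x.2 := by omega
    simp only [h1, h2]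
    push_cast at hx
    have : x.1 = 2 * k - x.2 := by omega
    rw [this] at hx
    nlinarith
  · intro x _; ext <;> simp <;> omega
  · intro x hx
    rw [mem_circ] at hx
    have hev : Even (x.1 + x.2) := by
      have : Even (x.1 ^ 2 + x.2 ^ 2) := by rw [hx]; simp
      simpa [Int.even_add, Int.even_pow] using this
    obtain ⟨k, hk⟩ := hev
    ext <;> simp <;> omega
  · intro x _; rfl

/-- `p ↦ p²` -/
noncomputable abbrev sq2 : PowerSeries ℚ →ₐ[ℚ] PowerSeries ℚ := PowerSeries.expand 2 two_ne_zero

lemma coeff_sq2_even (f : PowerSeries ℚ) (n : ℕ) :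
    PowerSeries.coeff (2 * n) (sq2 f) = PowerSeries.coeff n f :=
  PowerSeries.coeff_expand_mul 2 two_ne_zero f n

lemma coeff_sq2_odd (f : PowerSeries ℚ) (n : ℕ) :
    PowerSeries.coeff (2 * n + 1) (sq2 f) = 0 :=
  PowerSeries.coeff_expand_of_not_dvd 2 two_ne_zero f (by omega)

lemma theta_I1 : tha + thy = 2 * sq2 tha := by
  ext N
  rw [two_mul, map_add, map_add, coeff_tha, coeff_thy]
  obtain ⟨n, rfl | rfl⟩ := Nat.even_or_odd' N
  · rw [coeff_sq2_even, coeff_tha]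
    have : (circ (2 * n)).card = (circ n).card := by
      rw [Finset.card_eq_sum_ones, circ_two_mul, ← Finset.card_eq_sum_ones]
    rw [this]; simp [sg]
  · rw [coeff_sq2_odd]
    have : ¬ Even ((2 * n + 1 : ℕ) : ℤ) := by
      rw [Int.even_coe_nat]; simp
    simp only [sg, this, if_false]
    ring

lemma theta_I2' : th3 * th4 = sq2 thy := by
  ext N
  unfold th3 th4
  rw [coeff_thetaW_mul]
  simp only [one_mul]
  obtain ⟨n, rfl | rfl⟩ := Nat.even_or_odd' N
  · rw [coeff_sq2_even, coeff_thy, circ_two_mul]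
    rw [Finset.sum_congr rfl (g := fun _ => sg n)]
    · simp [mul_comm]
    · intro x hx
      rw [mem_circ] at hx
      rw [← hx, ← sg_sq_add]
      simp [sg, Int.even_add, Int.even_sub]
  · rw [coeff_sq2_odd]
    have h1 : ∑ x ∈ circ (2 * n + 1), sg x.2 = ∑ x ∈ circ (2 * n + 1), sg x.1 := by
      refine Finset.sum_bij' (fun x _ => (x.2, x.1)) (fun x _ => (x.2, x.1)) ?_ ?_ ?_ ?_ ?_ <;>
        simp [mem_circ, add_comm]
    have h2 : ∑ x ∈ circ (2 * n + 1), sg x.2 = - ∑ x ∈ circ (2 * n + 1), sg x.1 := by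
      rw [← Finset.sum_neg_distrib]
      refine Finset.sum_congr rfl fun x hx => ?_
      rw [mem_circ] at hx
      have : ¬ Even (x.1 ^ 2 + x.2 ^ 2) := by rw [hx, Int.even_coe_nat]; simp
      simp only [Int.even_add, Int.even_pow] at this
      unfold sg
      by_cases hi : Even x.1 <;> by_cases hj : Even x.2 <;> simp [hi, hj] at this ⊢
    linarith

lemma theta_I2 : sq2 thy * sq2 thy = tha * thy := by
  rw [← theta_I2']; unfold tha thy; ring

lemma Dp_sq2 (f : PowerSeries ℚ) : Dp ℚ (sq2 f) = 2 * sq2 (Dp ℚ f) := by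
  ext N
  rw [coeff_Dp, two_mul, map_add]
  obtain ⟨n, rfl | rfl⟩ := Nat.even_or_odd' N
  · rw [coeff_sq2_even, coeff_sq2_even, coeff_Dp]; push_cast; ring
  · rw [coeff_sq2_odd, coeff_sq2_odd]; simp

lemma circ_zero : (circ 0).card = 1 := by decide
lemma circ_one : (circ 1).card = 4 := by decide

lemma tha_zero : PowerSeries.constantCoeff tha = 1 := by
  rw [← PowerSeries.coeff_zero_eq_constantCoeff_apply, coeff_tha, circ_zero]; simp
lemma thy_zero : PowerSeries.constantCoeff thy = 1 := by
  rw [← PowerSeries.coeff_zero_eq_constantCoeff_apply, coeff_thy, circ_zero]; simp [sg]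
lemma tha_one : PowerSeries.coeff 1 tha = 4 := by rw [coeff_tha, circ_one]; simp
lemma thy_one : PowerSeries.coeff 1 thy = -4 := by rw [coeff_thy, circ_one]; simp [sg]


noncomputable def thu : PowerSeries ℚ := Dp ℚ thy * thy⁻¹
noncomputable def thal : PowerSeries ℚ := Dp ℚ tha * tha⁻¹

lemma tha_ne : tha ≠ 0 := fun h => by have := tha_zero; rw [h] at this; simp at this
lemma thy_ne : thy ≠ 0 := fun h => by have := thy_zero; rw [h] at this; simp at this

lemma Dp_thy : Dp ℚ thy = thu * thy := by
  unfold thu; rw [mul_assoc, PowerSeries.inv_mul_cancel _ (by rw [thy_zero]; simp), mul_one]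
lemma Dp_tha0 : Dp ℚ tha = thal * tha := by
  unfold thal; rw [mul_assoc, PowerSeries.inv_mul_cancel _ (by rw [tha_zero]; simp), mul_one]

lemma constantCoeff_Dp {R : Type*} [CommRing R] [Algebra ℚ R] (f : PowerSeries R) :
    PowerSeries.constantCoeff (Dp R f) = 0 := by
  rw [← PowerSeries.coeff_zero_eq_constantCoeff_apply, coeff_Dp]; simp

lemma thu_zero : PowerSeries.constantCoeff thu = 0 := by
  unfold thu; rw [map_mul, constantCoeff_Dp, zero_mul]
lemma thal_zero : PowerSeries.constantCoeff thal = 0 := by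
  unfold thal; rw [map_mul, constantCoeff_Dp, zero_mul]

lemma coeff_one_mul' (f g : PowerSeries ℚ) : PowerSeries.coeff 1 (f * g) =
    PowerSeries.constantCoeff f * PowerSeries.coeff 1 g
      + PowerSeries.coeff 1 f * PowerSeries.constantCoeff g := by
  rw [PowerSeries.coeff_mul, Finset.Nat.antidiagonal_succ]; simp

lemma thu_one : PowerSeries.coeff 1 thu = -4 := by
  have h := congrArg (PowerSeries.coeff 1) Dp_thy
  rw [coeff_Dp, coeff_one_mul', thu_zero, thy_zero, thy_one] at h
  push_cast at h; linarith
lemma thal_one : PowerSeries.coeff 1 thal = 4 := by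
  have h := congrArg (PowerSeries.coeff 1) Dp_tha0
  rw [coeff_Dp, coeff_one_mul', thal_zero, tha_zero, tha_one] at h
  push_cast at h; linarith

lemma Dp_two {R : Type*} [CommRing R] [Algebra ℚ R] : Dp R (2 : PowerSeries R) = 0 := by
  have : (2 : PowerSeries R) = ((2 : ℕ) : PowerSeries R) := by norm_num
  rw [this]; exact Derivation.map_natCast _ 2

lemma rel_al : tha * thal + thy * thu = 2 * (tha + thy) * sq2 thal := by
  have h := congrArg (Dp ℚ) theta_I1
  rw [Dp_mul, Dp_two, Dp_sq2, map_add, Dp_tha0, Dp_thy, map_mul] at h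
  linear_combination h - 2 * sq2 thal * theta_I1

lemma rel_u : 4 * sq2 thu = thal + thu := by
  have h := congrArg (Dp ℚ) theta_I2
  rw [Dp_mul, Dp_mul, Dp_sq2, Dp_tha0, Dp_thy, map_mul] at h
  apply mul_left_cancel₀ (mul_ne_zero tha_ne thy_ne)
  linear_combination h - 4 * sq2 thu * theta_I2

noncomputable def del : PowerSeries ℚ := 2 * (thal - thu) - (tha ^ 2 - thy ^ 2)

lemma sq2_two : sq2 2 = 2 := map_ofNat _ 2

lemma del_eq : 4 * (tha + thy) * sq2 del = (tha - thy) * del := by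
  unfold del
  rw [map_sub, map_sub, map_mul, map_sub, map_pow, map_pow, sq2_two]
  linear_combination (-4) * rel_al - 2 * (tha + thy) * rel_u + 4 * (tha + thy) * theta_I2
    + (tha + thy) * (tha + thy + 2 * sq2 tha) * theta_I1

lemma del_one : PowerSeries.coeff 1 del = 0 := by
  have h2 : (2 : PowerSeries ℚ) = PowerSeries.C 2 := (map_ofNat PowerSeries.C 2).symm
  unfold del
  rw [h2, map_sub, PowerSeries.coeff_C_mul, map_sub, map_sub, thal_one, thu_one, sq, sq,
    coeff_one_mul', coeff_one_mul', tha_zero, thy_zero, tha_one, thy_one]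
  norm_num

lemma del_zero : del = 0 := by
  by_contra hne
  have h := congrArg PowerSeries.order del_eq
  have h4 : (4 : PowerSeries ℚ) = PowerSeries.C 4 := (map_ofNat PowerSeries.C 4).symm
  have o1 : (4 * (tha + thy)).order = 0 := by
    have : PowerSeries.constantCoeff (4 * (tha + thy)) ≠ 0 := by
      rw [h4]; simp [tha_zero, thy_zero]
    exact PowerSeries.order_zero_of_unit (by rw [PowerSeries.isUnit_iff_constantCoeff]; exact this.isUnit)
  have o2 : (tha - thy).order = 1 := by
    refine (PowerSeries.order_eq_nat (n := 1)).2 ⟨?_, ?_⟩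
    · rw [map_sub, tha_one, thy_one]; norm_num
    · intro i hi
      have : i = 0 := by omega
      subst this
      simp [tha_zero, thy_zero]
  rw [PowerSeries.order_mul (4 * (tha + thy)), PowerSeries.order_mul (tha - thy), o1, o2, PowerSeries.order_expand] at h
  have hc := PowerSeries.coeff_order hne
  have hN := ENat.natCast_toNat (mt PowerSeries.order_eq_top.1 hne)
  rw [← hN] at h
  have : del.order.toNat = 1 := by
    generalize del.order.toNat = N at h
    rw [zero_add, nsmul_eq_mul] at h
    have h' : 2 * N = 1 + N := by exact_mod_cast h
    omega
  rw [this] at hc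
  exact hc del_one

lemma thal_eq : 2 * thal = 2 * thu + (tha ^ 2 - thy ^ 2) := by
  have := del_zero
  unfold del at this
  linear_combination this

noncomputable def eps : PowerSeries ℚ := 4 * Dp ℚ thu - 4 * thu ^ 2 + tha ^ 2 * (tha ^ 2 - thy ^ 2)

lemma eps_eq : 4 * sq2 eps = eps := by
  have h1 : 8 * sq2 thu = 4 * thu + (tha ^ 2 - thy ^ 2) := by
    linear_combination 2 * rel_u + thal_eq
  have h2 := congrArg (Dp ℚ) h1
  have d8 : Dp ℚ (8 : PowerSeries ℚ) = 0 := Derivation.map_natCast _ 8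
  have d4 : Dp ℚ (4 : PowerSeries ℚ) = 0 := Derivation.map_natCast _ 4
  rw [Dp_mul, d8, Dp_sq2, map_add, Dp_mul, d4, map_sub, sq, sq, Dp_mul, Dp_mul, Dp_tha0,
    Dp_thy] at h2
  have s4 : sq2 4 = 4 := map_ofNat _ 4
  unfold eps
  rw [map_add, map_sub, map_mul, map_mul, map_mul, map_sub, map_pow, map_pow, map_pow, s4]
  have hA : 4 * sq2 tha ^ 2 = (tha + thy) ^ 2 := by
    rw [theta_I1]; ring
  have h16 : (4 : PowerSeries ℚ) ≠ 0 := by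
    have : (4 : PowerSeries ℚ) = PowerSeries.C 4 := (map_ofNat PowerSeries.C 4).symm
    rw [this]; intro h
    have := congrArg PowerSeries.constantCoeff h
    simp at this
  apply mul_left_cancel₀ h16
  linear_combination 4 * h2 + 4 * tha ^ 2 * thal_eq
    - (8 * sq2 thu + 4 * thu + (tha ^ 2 - thy ^ 2)) * h1
    + (4 * sq2 tha ^ 2) * hA + ((tha + thy) ^ 2 - 4 * (tha * thy)) * hA  - 16 * sq2 tha ^ 2 * theta_I2

lemma eps_zero : eps = 0 := by
  by_contra hne
  have h := congrArg PowerSeries.order eps_eq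
  have h4 : (4 : PowerSeries ℚ) = PowerSeries.C 4 := (map_ofNat PowerSeries.C 4).symm
  have o1 : (4 : PowerSeries ℚ).order = 0 := by
    have : PowerSeries.constantCoeff (4 : PowerSeries ℚ) ≠ 0 := by
      rw [h4]; simp
    exact PowerSeries.order_zero_of_unit (by rw [PowerSeries.isUnit_iff_constantCoeff]; exact this.isUnit)
  rw [PowerSeries.order_mul, o1, PowerSeries.order_expand] at h
  have hc := PowerSeries.coeff_order hne
  have hN := ENat.natCast_toNat (mt PowerSeries.order_eq_top.1 hne)
  rw [← hN] at h
  have : eps.order.toNat = 0 := by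
    generalize eps.order.toNat = N at h
    rw [zero_add, nsmul_eq_mul] at h
    have h' : 2 * N = N := by exact_mod_cast h
    omega
  rw [this] at hc
  apply hc
  have := congrArg PowerSeries.constantCoeff eps_eq
  rw [map_mul, h4, PowerSeries.constantCoeff_C, PowerSeries.constantCoeff_expand] at this
  simp only [PowerSeries.coeff_zero_eq_constantCoeff_apply]
  linarith

lemma Dp_thu : 4 * Dp ℚ thu = 4 * thu ^ 2 - tha ^ 2 * (tha ^ 2 - thy ^ 2) := by
  have := eps_zero
  unfold eps at this
  linear_combination this


/-- Formal sum of a family of power series whose orders tend to infinity. -/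
noncomputable def psum {R : Type*} [CommRing R] (F : ℕ → PowerSeries R) : PowerSeries R :=
  PowerSeries.mk fun N => ∑ m ∈ Finset.range (N + 1), PowerSeries.coeff N (F m)

def Good {R : Type*} [CommRing R] (F : ℕ → PowerSeries R) : Prop :=
  ∀ m N, N < m → PowerSeries.coeff N (F m) = 0

lemma coeff_psum {R : Type*} [CommRing R] {F : ℕ → PowerSeries R} (hF : Good F) (N M : ℕ)
    (h : N < M) :
    PowerSeries.coeff N (psum F) = ∑ m ∈ Finset.range M, PowerSeries.coeff N (F m) := by
  rw [psum, PowerSeries.coeff_mk]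
  refine Finset.sum_subset (Finset.range_mono h) fun m _ hm => hF m N ?_
  simp at hm; omega

lemma Good.mul {R : Type*} [CommRing R] {F : ℕ → PowerSeries R} (hF : Good F)
    (A : PowerSeries R) : Good fun m => A * F m := by
  intro m N h
  rw [PowerSeries.coeff_mul]
  refine Finset.sum_eq_zero fun x hx => ?_
  rw [Finset.HasAntidiagonal.mem_antidiagonal] at hx
  rw [hF m x.2 (by omega), mul_zero]

lemma psum_mul {R : Type*} [CommRing R] {F : ℕ → PowerSeries R} (hF : Good F)
    (A : PowerSeries R) : psum (fun m => A * F m) = A * psum F := by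
  ext N
  rw [coeff_psum (hF.mul A) N (N + 1) (by omega), PowerSeries.coeff_mul]
  simp only [PowerSeries.coeff_mul]
  rw [Finset.sum_comm]
  refine Finset.sum_congr rfl fun x hx => ?_
  rw [Finset.HasAntidiagonal.mem_antidiagonal] at hx
  rw [coeff_psum hF x.2 (N + 1) (by omega), Finset.mul_sum]

lemma psum_add {R : Type*} [CommRing R] (F G : ℕ → PowerSeries R) :
    psum (fun m => F m + G m) = psum F + psum G := by
  ext N
  simp [psum, Finset.sum_add_distrib]

lemma psum_shift {R : Type*} [CommRing R] {F : ℕ → PowerSeries R} (hF : Good F) :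
    psum F = F 0 + psum (fun m => F (m + 1)) := by
  ext N
  rw [map_add, coeff_psum hF N (N + 2) (by omega), Finset.sum_range_succ' _ (N + 1), add_comm,
    psum, PowerSeries.coeff_mk]

lemma psum_Dp {R : Type*} [CommRing R] [Algebra ℚ R] (F : ℕ → PowerSeries R) :
    psum (fun m => Dp R (F m)) = Dp R (psum F) := by
  ext N
  rw [coeff_Dp]
  simp only [psum, PowerSeries.coeff_mk, coeff_Dp, Finset.mul_sum]

/-- apply a linear map to all the coefficients -/
noncomputable def mc {A B : Type*} [CommRing A] [CommRing B] [Algebra ℚ A] [Algebra ℚ B]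
    (φ : A →ₗ[ℚ] B) (f : PowerSeries A) : PowerSeries B :=
  PowerSeries.mk fun n => φ (PowerSeries.coeff n f)

set_option linter.unusedSectionVars false

section mc
variable {A B : Type*} [CommRing A] [CommRing B] [Algebra ℚ A] [Algebra ℚ B] (φ : A →ₗ[ℚ] B)

lemma coeff_mc (f : PowerSeries A) (n : ℕ) :
    PowerSeries.coeff n (mc φ f) = φ (PowerSeries.coeff n f) := by
  rw [mc, PowerSeries.coeff_mk]

lemma mc_add (f g : PowerSeries A) : mc φ (f + g) = mc φ f + mc φ g := by
  ext n; simp [coeff_mc]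

lemma mc_neg (f : PowerSeries A) : mc φ (-f) = - mc φ f := by
  ext n; simp [coeff_mc]

lemma mc_sub (f g : PowerSeries A) : mc φ (f - g) = mc φ f - mc φ g := by
  ext n; simp [coeff_mc]

lemma psum_mc (F : ℕ → PowerSeries A) : psum (fun m => mc φ (F m)) = mc φ (psum F) := by
  ext N
  simp [psum, coeff_mc]

lemma mc_Dp (f : PowerSeries A) : mc φ (Dp A f) = Dp B (mc φ f) := by
  ext n
  rw [coeff_mc, coeff_Dp, coeff_Dp, coeff_mc, ← nsmul_eq_mul, map_nsmul, nsmul_eq_mul]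

lemma mc_map_mul (c : PowerSeries ℚ) (f : PowerSeries A) :
    mc φ (PowerSeries.map (algebraMap ℚ A) c * f) = PowerSeries.map (algebraMap ℚ B) c * mc φ f := by
  ext n
  rw [coeff_mc, PowerSeries.coeff_mul, PowerSeries.coeff_mul, map_sum]
  refine Finset.sum_congr rfl fun x _ => ?_
  rw [PowerSeries.coeff_map, PowerSeries.coeff_map, coeff_mc, ← Algebra.smul_def, map_smul,
    Algebra.smul_def]

lemma mc_X_pow_mul (m : ℕ) (f : PowerSeries A) :
    mc φ (PowerSeries.X ^ m * f) = PowerSeries.X ^ m * mc φ f := by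
  ext n
  rw [coeff_mc, PowerSeries.coeff_X_pow_mul', PowerSeries.coeff_X_pow_mul']
  split_ifs <;> simp [coeff_mc]

lemma mc_natCast_mul (m : ℕ) (f : PowerSeries A) :
    mc φ (m * f) = m * mc φ f := by
  ext n
  rw [coeff_mc, ← nsmul_eq_mul, ← nsmul_eq_mul, map_nsmul, map_nsmul, map_nsmul, coeff_mc]

lemma mc_derivation_mul (d : Derivation ℚ A A) (f g : PowerSeries A) :
    mc (d : A →ₗ[ℚ] A) (f * g) = mc (d : A →ₗ[ℚ] A) f * g + f * mc (d : A →ₗ[ℚ] A) g := by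
  ext n
  rw [coeff_mc, map_add, PowerSeries.coeff_mul, PowerSeries.coeff_mul, PowerSeries.coeff_mul,
    map_sum, ← Finset.sum_add_distrib]
  refine Finset.sum_congr rfl fun x _ => ?_
  rw [coeff_mc, coeff_mc]
  simp only [Derivation.coeFn_coe, Derivation.leibniz, smul_eq_mul]
  ring

lemma mc_derivation_C_mul (d : Derivation ℚ A A) (x : A) (g : PowerSeries A) :
    mc (d : A →ₗ[ℚ] A) (PowerSeries.C x * g)
      = PowerSeries.C (d x) * g + PowerSeries.C x * mc (d : A →ₗ[ℚ] A) g := by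
  rw [mc_derivation_mul]
  congr 2
  ext n
  rw [coeff_mc, PowerSeries.coeff_C, PowerSeries.coeff_C]
  split_ifs <;> simp

lemma mc_derivation_map (d : Derivation ℚ A A) (c : PowerSeries ℚ) :
    mc (d : A →ₗ[ℚ] A) (PowerSeries.map (algebraMap ℚ A) c) = 0 := by
  ext n
  rw [coeff_mc, PowerSeries.coeff_map]
  simp

lemma Dp_map (c : PowerSeries ℚ) : Dp A (PowerSeries.map (algebraMap ℚ A) c)
    = PowerSeries.map (algebraMap ℚ A) (Dp ℚ c) := by
  ext n
  rw [coeff_Dp, PowerSeries.coeff_map, PowerSeries.coeff_map, coeff_Dp]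
  simp

lemma Dp_C (x : A) : Dp A (PowerSeries.C x) = 0 := by
  ext n
  rw [coeff_Dp, PowerSeries.coeff_C]
  split_ifs with h <;> simp [h]

/-- coefficientwise extension of a derivation -/
noncomputable def mcD (d : Derivation ℚ A A) : Derivation ℚ (PowerSeries A) (PowerSeries A) :=
  Derivation.mk'
    { toFun := mc (d : A →ₗ[ℚ] A)
      map_add' := mc_add _
      map_smul' := by intro c f; ext n; simp [coeff_mc] }
    (by
      intro f g
      simp only [LinearMap.coe_mk, AddHom.coe_mk, smul_eq_mul]
      rw [mc_derivation_mul]; ring)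

lemma mcD_apply (d : Derivation ℚ A A) (f : PowerSeries A) : mcD d f = mc (d : A →ₗ[ℚ] A) f := rfl

/-- exponential of a power series without constant term -/
noncomputable def pexp (f : PowerSeries A) : PowerSeries A :=
  psum fun k => ((1 : ℚ) / (k.factorial : ℚ)) • f ^ k

lemma coeff_pow_eq_zero {f : PowerSeries A} (hf : PowerSeries.constantCoeff f = 0) (m N : ℕ)
    (h : N < m) : PowerSeries.coeff N (f ^ m) = 0 := by
  have : (PowerSeries.X : PowerSeries A) ^ m ∣ f ^ m :=
    pow_dvd_pow_of_dvd (PowerSeries.X_dvd_iff.2 hf) m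
  exact PowerSeries.X_pow_dvd_iff.1 this N h

lemma coeff_smul_rat (c : ℚ) (f : PowerSeries A) (n : ℕ) :
    PowerSeries.coeff n (c • f) = c • PowerSeries.coeff n f := rfl

lemma pexp_derivation {f : PowerSeries A} (hf : PowerSeries.constantCoeff f = 0)
    (d : Derivation ℚ (PowerSeries A) (PowerSeries A))
    (h1 : ∀ F : ℕ → PowerSeries A, psum (fun m => d (F m)) = d (psum F))
    (h2 : ∀ (g : PowerSeries A) (N : ℕ), PowerSeries.coeff N g = 0 →
      PowerSeries.coeff N (d g) = 0) : d (pexp f) = d f * pexp f := by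
  have hg : Good fun k : ℕ => ((1 : ℚ) / (k.factorial : ℚ)) • f ^ k := by
    intro m N h
    rw [coeff_smul_rat, coeff_pow_eq_zero hf m N h, smul_zero]
  have hg' : Good fun k : ℕ => d (((1 : ℚ) / (k.factorial : ℚ)) • f ^ k) :=
    fun m N h => h2 _ _ (hg m N h)
  rw [pexp, ← h1, psum_shift hg', ← psum_mul hg]
  have h0 : d (((1 : ℚ) / (Nat.factorial 0 : ℚ)) • f ^ 0) = 0 := by simp
  rw [h0, zero_add]
  congr 1
  funext k
  rw [Derivation.map_smul, Derivation.leibniz_pow, Nat.add_sub_cancel, Nat.factorial_succ,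
    mul_smul_comm, ← Nat.cast_smul_eq_nsmul ℚ, smul_smul, smul_eq_mul, mul_comm (d f)]
  congr 1
  have : (k.factorial : ℚ) ≠ 0 := by exact_mod_cast k.factorial_ne_zero
  push_cast
  field_simp

lemma pexp_zero_of (e : A →ₐ[ℚ] ℚ) {f : PowerSeries A}
    (hf : mc e.toLinearMap f = 0) :
    PowerSeries.map (e : A →+* ℚ) (pexp f) = 1 := by
  have hm : ∀ g : PowerSeries A, PowerSeries.map (e : A →+* ℚ) g = mc e.toLinearMap g := by
    intro g; ext n; simp [coeff_mc]
  rw [hm, pexp, ← psum_mc]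
  have : ∀ m : ℕ, mc e.toLinearMap (((1 : ℚ) / (m.factorial : ℚ)) • f ^ m)
      = if m = 0 then 1 else 0 := by
    intro m
    have h3 : mc e.toLinearMap (((1 : ℚ) / (m.factorial : ℚ)) • f ^ m)
        = ((1 : ℚ) / (m.factorial : ℚ)) • mc e.toLinearMap (f ^ m) := by
      ext n; simp [coeff_mc]
    rw [h3, ← hm, map_pow, hm, hf]
    split_ifs with h
    · subst h; simp
    · rw [zero_pow h, smul_zero]
  simp only [this]
  rw [psum_shift]
  · simp only [if_true, Nat.succ_ne_zero, if_false]
    ext n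
    simp [psum]
  · intro m N h
    have hm0 : m ≠ 0 := by omega
    simp [hm0]

end mc

noncomputable def thmu : PowerSeries ℚ := (1 / 4 : ℚ) • (1 - (thy * tha⁻¹) ^ 2)

lemma four_smul_quarter (f : PowerSeries ℚ) : 4 * ((1 / 4 : ℚ) • f) = f := by
  have h4 : (4 : PowerSeries ℚ) = PowerSeries.C 4 := (map_ofNat PowerSeries.C 4).symm
  ext n
  rw [h4, PowerSeries.coeff_C_mul]
  simp

lemma thmu_rel : 4 * thmu * tha ^ 2 = tha ^ 2 - thy ^ 2 := by
  have h : tha⁻¹ * tha = 1 := PowerSeries.inv_mul_cancel _ (by rw [tha_zero]; simp)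
  rw [thmu, four_smul_quarter]
  linear_combination (- thy ^ 2 * (tha⁻¹ * tha + 1)) * h

lemma four_ne : (4 : PowerSeries ℚ) ≠ 0 := by
  have h4 : (4 : PowerSeries ℚ) = PowerSeries.C 4 := (map_ofNat PowerSeries.C 4).symm
  rw [h4]; intro h
  have := congrArg PowerSeries.constantCoeff h
  simp at this

lemma Dp_thu' : Dp ℚ thu = thu ^ 2 - thmu * tha ^ 4 := by
  apply mul_left_cancel₀ four_ne
  linear_combination Dp_thu + tha ^ 2 * thmu_rel

lemma Dp_tha : Dp ℚ tha = (thu + 2 * thmu * tha ^ 2) * tha := by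
  apply mul_left_cancel₀ four_ne
  rw [Dp_tha0]
  linear_combination 2 * tha * thal_eq - 2 * tha * thmu_rel

lemma thmu_zero : PowerSeries.constantCoeff thmu = 0 := by
  have := congrArg PowerSeries.constantCoeff thmu_rel
  have h4 : (4 : PowerSeries ℚ) = PowerSeries.C 4 := (map_ofNat PowerSeries.C 4).symm
  rw [h4] at this
  simpa [tha_zero, thy_zero] using this

lemma Dp_thmu : Dp ℚ thmu = thmu * thy ^ 2 := by
  have h := congrArg (Dp ℚ) thmu_rel
  have d4 : Dp ℚ (4 : PowerSeries ℚ) = 0 := Derivation.map_natCast _ 4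
  rw [sq, sq, Dp_mul, Dp_mul, Dp_mul, map_sub, Dp_mul, Dp_mul, d4, Dp_thy, Dp_tha] at h
  apply mul_left_cancel₀ (mul_ne_zero four_ne (pow_ne_zero 2 tha_ne))
  linear_combination h + (-2 * thu - 4 * thmu * tha ^ 2) * thmu_rel

lemma thmu_one : PowerSeries.coeff 1 thmu = 4 := by
  have := congrArg (PowerSeries.coeff 1) thmu_rel
  have h4 : (4 : PowerSeries ℚ) = PowerSeries.C 4 := (map_ofNat PowerSeries.C 4).symm
  rw [h4, mul_assoc, PowerSeries.coeff_C_mul, map_sub, coeff_one_mul', sq, sq, coeff_one_mul',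
    coeff_one_mul', map_mul, tha_zero, thy_zero, tha_one, thy_one, thmu_zero] at this
  linarith

/-- abbreviation: scalars in `ℚ[t]⟦p⟧` -/
noncomputable abbrev tau : PowerSeries ℚ →+* PowerSeries ℚ[X] :=
  PowerSeries.map (algebraMap ℚ ℚ[X])

lemma constantCoeff_tau (c : PowerSeries ℚ) : PowerSeries.constantCoeff (tau c)
    = algebraMap ℚ ℚ[X] (PowerSeries.constantCoeff c) := by
  rw [← PowerSeries.coeff_zero_eq_constantCoeff_apply, PowerSeries.coeff_map,
    PowerSeries.coeff_zero_eq_constantCoeff_apply]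

noncomputable abbrev tt : PowerSeries ℚ[X] := PowerSeries.C (X : ℚ[X])

noncomputable def rr : PowerSeries ℚ[X] := tau tha ^ 2 + tau thu * tt
noncomputable def rho : PowerSeries ℚ[X] := PowerSeries.invOfUnit rr 1

lemma rr_zero : PowerSeries.constantCoeff rr = 1 := by
  simp [rr, tha_zero, thu_zero, constantCoeff_tau]

lemma rr_rho : rr * rho = 1 := PowerSeries.mul_invOfUnit _ _ (by rw [rr_zero]; simp)

/-- coefficientwise d/dt -/
noncomputable abbrev dt : Derivation ℚ (PowerSeries ℚ[X]) (PowerSeries ℚ[X]) :=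
  mcD (Polynomial.derivative' : Derivation ℚ ℚ[X] ℚ[X])

lemma dt_mul (f g : PowerSeries ℚ[X]) : dt (f * g) = dt f * g + f * dt g := by
  rw [Derivation.leibniz]; simp only [smul_eq_mul]; ring

lemma dt_tau (c : PowerSeries ℚ) : dt (tau c) = 0 := by
  rw [mcD_apply]; exact mc_derivation_map _ c

lemma dt_tt : dt tt = 1 := by
  have := mc_derivation_C_mul (Polynomial.derivative' : Derivation ℚ ℚ[X] ℚ[X]) X 1
  rw [mul_one] at this
  rw [mcD_apply, this]
  have h1 : mc ((Polynomial.derivative' : Derivation ℚ ℚ[X] ℚ[X]) : ℚ[X] →ₗ[ℚ] ℚ[X]) 1 = 0 :=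
    (mcD (Polynomial.derivative' : Derivation ℚ ℚ[X] ℚ[X])).map_one_eq_zero
  rw [h1]
  simp

lemma Dp_tau (c : PowerSeries ℚ) : Dp ℚ[X] (tau c) = tau (Dp ℚ c) := Dp_map c
lemma Dp_tt : Dp ℚ[X] tt = 0 := Dp_C _

lemma dt_rr : dt rr = tau thu := by
  rw [rr, map_add, sq, dt_mul, dt_mul, dt_tau, dt_tau, dt_tt]; ring

lemma Dp_rr : Dp ℚ[X] rr = 2 * tau tha ^ 2 * (tau thu + 2 * tau thmu * tau tha ^ 2)
    + (tau thu ^ 2 - tau thmu * tau tha ^ 4) * tt := by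
  rw [rr, map_add, sq, Dp_mul, Dp_mul, Dp_tau, Dp_tau, Dp_tt, Dp_tha, Dp_thu']
  simp only [map_mul, map_add, map_sub, map_pow, map_ofNat]; ring

lemma dt_rho : dt rho = - rho ^ 2 * tau thu := by
  have h := congrArg dt rr_rho
  rw [dt_mul, dt_rr, Derivation.map_one_eq_zero] at h
  linear_combination rho * h - dt rho * rr_rho

lemma Dp_rho : Dp ℚ[X] rho = - rho ^ 2 * (2 * tau tha ^ 2 * (tau thu + 2 * tau thmu * tau tha ^ 2)
    + (tau thu ^ 2 - tau thmu * tau tha ^ 4) * tt) := by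
  have h := congrArg (Dp ℚ[X]) rr_rho
  rw [Dp_mul, Dp_rr, Derivation.map_one_eq_zero] at h
  linear_combination rho * h - Dp ℚ[X] rho * rr_rho

noncomputable def ell : PowerSeries ℚ[X] := tt * rho
noncomputable def beta : PowerSeries ℚ[X] := 1 - 4 * tau thmu * tt + tau thmu * tt ^ 2

lemma E1 : Dp ℚ[X] ell - tau tha ^ 2 * beta * dt ell = -1 := by
  have hr := rr_rho
  rw [ell, Dp_mul, dt_mul, Dp_tt, dt_tt, Dp_rho, dt_rho, beta]
  rw [rr] at hr
  linear_combination (tau tha ^ 2 * (1 - 4 * tau thmu * tt + tau thmu * tt ^ 2) * rho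
    - ((tau tha ^ 2 + tau thu * tt) * rho + 1)) * hr

noncomputable def VV : PowerSeries ℚ[X] := tau (tha ^ 2 * thy⁻¹) * rho

lemma Dp_thyinv : Dp ℚ thy⁻¹ = - thu * thy⁻¹ := by
  have h1 : thy⁻¹ * thy = 1 := PowerSeries.inv_mul_cancel _ (by rw [thy_zero]; simp)
  have h := congrArg (Dp ℚ) h1
  rw [Dp_mul, Dp_thy, Derivation.map_one_eq_zero] at h
  linear_combination thy⁻¹ * h - (Dp ℚ thy⁻¹ + thu * thy⁻¹) * h1

lemma E2 : Dp ℚ[X] VV - tau tha ^ 2 * beta * dt VV = tau tha ^ 2 * tau thmu * tt * VV := by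
  have hr := rr_rho
  rw [VV, Dp_mul, dt_mul, dt_tau, Dp_tau, Dp_rho, dt_rho, beta, Dp_mul, sq, Dp_mul, Dp_thyinv, Dp_tha]
  simp only [map_mul, map_add, map_neg, map_pow, map_ofNat]
  rw [rr] at hr
  linear_combination (-(tau tha ^ 2 * tau thy⁻¹ * rho) * ((tau thu + 4 * tau thmu * tau tha ^ 2) -  tau tha ^ 2 * tau thmu * tt)) * hr

noncomputable def xe : PowerSeries ℚ[X] := pexp (ell - tt)

lemma ell_zero : PowerSeries.constantCoeff (ell - tt) = 0 := by
  have h := congrArg PowerSeries.constantCoeff rr_rho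
  rw [map_mul, rr_zero, one_mul] at h
  rw [map_sub, ell, map_mul, h]; simp

lemma Dp_xe : Dp ℚ[X] xe = Dp ℚ[X] ell * xe := by
  have := pexp_derivation ell_zero ((Dp ℚ[X])) psum_Dp
    (by intro g N h; rw [coeff_Dp, h, mul_zero])
  rw [map_sub, Dp_tt, sub_zero] at this
  exact this

lemma dt_xe : dt xe = (dt ell - 1) * xe := by
  have := pexp_derivation ell_zero dt (by intro F; simp only [mcD_apply]; exact psum_mc _ F)
    (by intro g N h; rw [mcD_apply, coeff_mc, h, map_zero])
  rw [map_sub, dt_tt] at this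
  exact this

noncomputable def PP (m : ℕ) : PowerSeries ℚ[X] := xe ^ m * VV

lemma derivation_pow {R : Type*} [CommRing R] [Algebra ℚ R] (d : Derivation ℚ R R) (x w : R)
    (h : d x = w * x) (m : ℕ) : d (x ^ m) = m * w * x ^ m := by
  induction m with
  | zero => simp
  | succ k ih =>
    rw [pow_succ, Derivation.leibniz, ih, h]
    simp only [smul_eq_mul]; push_cast; ring

lemma PDE (m : ℕ) : Dp ℚ[X] (PP m) + m * PP m
    = tau (tha ^ 2) * (beta * (dt (PP m) + m * PP m) + tau thmu * tt * PP m) := by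
  have h1 : Dp ℚ[X] (xe ^ m) = m * Dp ℚ[X] ell * xe ^ m :=
    derivation_pow ((Dp ℚ[X])) _ _ Dp_xe m
  have h2 : dt (xe ^ m) = m * (dt ell - 1) * xe ^ m := derivation_pow dt _ _ dt_xe m
  rw [PP, Dp_mul, dt_mul, h1, h2, map_pow]
  linear_combination (m * xe ^ m * VV) * E1 + xe ^ m * E2

/-- evaluation at `t = 0` -/
noncomputable abbrev ev0 : ℚ[X] →ₐ[ℚ] ℚ := Polynomial.aeval (0 : ℚ)

lemma ev0_tau (c : PowerSeries ℚ) : PowerSeries.map (ev0 : ℚ[X] →+* ℚ) (tau c) = c := by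
  ext n; simp

lemma ev0_tt : PowerSeries.map (ev0 : ℚ[X] →+* ℚ) tt = 0 := by
  simp [tt]

lemma ev0_PP (m : ℕ) : PowerSeries.map (ev0 : ℚ[X] →+* ℚ) (PP m) = thy⁻¹ := by
  have h := congrArg (PowerSeries.map (ev0 : ℚ[X] →+* ℚ)) rr_rho
  rw [map_mul, map_one, rr, map_add, map_mul, map_pow, ev0_tau, ev0_tau, ev0_tt] at h
  have hx : PowerSeries.map (ev0 : ℚ[X] →+* ℚ) xe = 1 := by
    apply pexp_zero_of
    have : ∀ g : PowerSeries ℚ[X], mc ev0.toLinearMap g = PowerSeries.map (ev0 : ℚ[X] →+* ℚ) g := by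
      intro g; ext n; simp [coeff_mc]
    rw [this, map_sub, ell, map_mul, ev0_tt]; simp
  rw [PP, map_mul, map_pow, hx, one_pow, VV, map_mul, ev0_tau]
  linear_combination thy⁻¹ * h

lemma PP_zero (m : ℕ) : PowerSeries.coeff 0 (PP m) = 1 := by
  have h := congrArg PowerSeries.constantCoeff rr_rho
  rw [map_mul, rr_zero, one_mul] at h
  have hx : PowerSeries.constantCoeff xe = 1 := by
    rw [xe, pexp, ← PowerSeries.coeff_zero_eq_constantCoeff_apply, psum, PowerSeries.coeff_mk]
    simp
  rw [PowerSeries.coeff_zero_eq_constantCoeff_apply, PP, map_mul, map_pow, hx, VV, map_mul, h]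
  simp [tha_zero, thy_zero, constantCoeff_tau]

section laplace
variable {K : Type*} [Field K] [Algebra ℚ K]

/-- formal Laplace transform of `P(t) e^{mt}` -/
noncomputable def lap (s : K) (m : ℕ) : ℚ[X] →ₗ[ℚ] K :=
  Polynomial.lsum fun k => LinearMap.toSpanSingleton ℚ K ((k.factorial : K) / (s - m) ^ (k + 1))

lemma lap_monomial (s : K) (m k : ℕ) (c : ℚ) :
    lap s m (Polynomial.monomial k c) = c • ((k.factorial : K) / (s - m) ^ (k + 1)) := by
  simp [lap, Polynomial.lsum_apply, Polynomial.sum_monomial_index]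

lemma der_inv_pow (d : Derivation ℚ K K) (z : K) (hz : d z = 1) (hz0 : z ≠ 0) (k : ℕ) :
    d (1 / z ^ k) = - (k : K) / z ^ (k + 1) := by
  have h := congrArg d (one_div_mul_cancel (pow_ne_zero k hz0))
  rw [Derivation.leibniz, Derivation.leibniz_pow, Derivation.map_one_eq_zero, hz] at h
  simp only [smul_eq_mul, nsmul_eq_mul, mul_one] at h
  cases k with
  | zero => simp
  | succ k =>
    rw [Nat.add_sub_cancel] at h
    have h2 : z ^ (k+1) ≠ 0 := pow_ne_zero _ hz0
    have h3 : z ^ k ≠ 0 := pow_ne_zero _ hz0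
    rw [eq_div_iff (pow_ne_zero _ hz0)]
    have h4 : 1 / z ^ (k + 1) * z ^ (k + 1) = 1 := one_div_mul_cancel h2
    linear_combination z * h - ((k + 1 : ℕ) : K) * h4

lemma lap_X_mul (d : Derivation ℚ K K) (s : K) (hs : d s = 1) (m : ℕ) (hsm : s - m ≠ 0)
    (P : ℚ[X]) : lap s m (X * P) = - d (lap s m P) := by
  induction P using Polynomial.induction_on' with
  | add p q hp hq => rw [mul_add, map_add, hp, hq, map_add, map_add]; ring
  | monomial k c =>
    rw [Polynomial.X_mul_monomial, lap_monomial, lap_monomial, Derivation.map_smul]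
    rw [Algebra.smul_def, Algebra.smul_def, ← mul_neg]
    congr 1
    have hz : d (s - m) = 1 := by rw [map_sub, hs, Derivation.map_natCast, sub_zero]
    have e : (k.factorial : K) / (s - m) ^ (k + 1) = (k.factorial : K) * (1 / (s - m) ^ (k + 1)) := by
      ring
    rw [e, Derivation.leibniz, Derivation.map_natCast, der_inv_pow d _ hz hsm]
    simp only [smul_eq_mul, Nat.factorial_succ]
    push_cast
    ring

lemma lap_deriv (s : K) (m : ℕ) (hsm : s - m ≠ 0) (P : ℚ[X]) :
    lap s m (Polynomial.derivative P + m * P) = s * lap s m P - algebraMap ℚ K (P.eval 0) := by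
  induction P using Polynomial.induction_on' with
  | add p q hp hq =>
    rw [Polynomial.derivative_add, Polynomial.eval_add, map_add (algebraMap ℚ K), map_add (lap s m) p q]
    have : (Polynomial.derivative p + Polynomial.derivative q + m * (p + q) : ℚ[X])
      = (Polynomial.derivative p + m * p) + (Polynomial.derivative q + m * q) := by ring
    rw [this, map_add (lap s m), hp, hq]; ring
  | monomial k c =>
    rw [map_add, Polynomial.derivative_monomial, ← nsmul_eq_mul, map_nsmul, nsmul_eq_mul,
      lap_monomial, lap_monomial]
    simp only [Algebra.smul_def]
    cases k with
    | zero => simp; field_simp; ring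
    | succ k =>
      simp only [Polynomial.eval_monomial, Nat.add_sub_cancel, Nat.factorial_succ, map_mul,
        Nat.succ_ne_zero, zero_pow, ne_eq, not_false_eq_true, map_zero, mul_zero, sub_zero]
      have h3 : (s - m) ^ k ≠ 0 := pow_ne_zero _ hsm
      push_cast
      simp only [pow_succ]
      field_simp
      simp

noncomputable abbrev iot (K : Type*) [Field K] [Algebra ℚ K] : PowerSeries ℚ →+* PowerSeries K :=
  PowerSeries.map (algebraMap ℚ K)

lemma mlap_tau (s : K) (m : ℕ) (c : PowerSeries ℚ) (f : PowerSeries ℚ[X]) :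
    mc (lap s m) (tau c * f) = iot K c * mc (lap s m) f := mc_map_mul _ c f

lemma mlap_tt (d : Derivation ℚ K K) (s : K) (hs : d s = 1) (m : ℕ) (hsm : s - m ≠ 0)
    (f : PowerSeries ℚ[X]) : mc (lap s m) (tt * f) = - mcD d (mc (lap s m) f) := by
  ext n
  rw [coeff_mc, PowerSeries.coeff_C_mul, lap_X_mul d s hs m hsm, map_neg, mcD_apply, coeff_mc,
    coeff_mc]
  rfl

lemma mlap_dt (s : K) (m : ℕ) (hsm : s - m ≠ 0) (f : PowerSeries ℚ[X]) :
    mc (lap s m) (dt f + m * f) = PowerSeries.C s * mc (lap s m) f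
      - iot K (PowerSeries.map (ev0 : ℚ[X] →+* ℚ) f) := by
  ext n
  rw [coeff_mc, map_sub, PowerSeries.coeff_C_mul, PowerSeries.coeff_map, PowerSeries.coeff_map,
    coeff_mc, map_add, mcD_apply, coeff_mc]
  have h1 : PowerSeries.coeff n ((m : PowerSeries ℚ[X]) * f) = m * PowerSeries.coeff n f := by
    rw [← nsmul_eq_mul, map_nsmul, nsmul_eq_mul]
  rw [h1]
  have := lap_deriv s m hsm (PowerSeries.coeff n f)
  simpa [Polynomial.aeval_def, Polynomial.eval₂_eq_eval_map] using this

/-- the operator sending x to four times the derivative of s x plus the derivative of s dx -/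
noncomputable def phi (d : Derivation ℚ K K) (s : K) : K →ₗ[ℚ] K where
  toFun x := 4 * d (s * x) + d (s * d x)
  map_add' x y := by simp only [mul_add, map_add]; ring
  map_smul' c x := by
    simp only [Derivation.map_smul, mul_smul_comm, RingHom.id_apply]
    simp only [Algebra.smul_def, mul_add]

lemma mc_phi (d : Derivation ℚ K K) (s : K) (f : PowerSeries K) :
    mc (phi d s) f = 4 * mcD d (PowerSeries.C s * f) + mcD d (PowerSeries.C s * mcD d f) := by
  have h4 : (4 : PowerSeries K) = PowerSeries.C 4 := (map_ofNat PowerSeries.C 4).symm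
  ext n
  rw [coeff_mc, map_add, h4, PowerSeries.coeff_C_mul]
  simp only [mcD_apply, coeff_mc, PowerSeries.coeff_C_mul]
  rfl

noncomputable def TT (s : K) (m : ℕ) : PowerSeries K := PowerSeries.X ^ m * mc (lap s m) (PP m)

lemma Dp_X_pow {R : Type*} [CommRing R] [Algebra ℚ R] (m : ℕ) :
    Dp R (PowerSeries.X ^ m : PowerSeries R) = (m : PowerSeries R) * PowerSeries.X ^ m := by
  ext n
  have : (m : PowerSeries R) = PowerSeries.C (m : R) := (map_natCast PowerSeries.C m).symm
  rw [coeff_Dp, this, PowerSeries.coeff_C_mul, PowerSeries.coeff_X_pow]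
  split_ifs with h
  · rw [h]
  · simp

lemma mcD_mul (d : Derivation ℚ K K) (f g : PowerSeries K) :
    mcD d (f * g) = mcD d f * g + f * mcD d g := mc_derivation_mul d f g

lemma mcD_iot (d : Derivation ℚ K K) (c : PowerSeries ℚ) : mcD d (iot K c) = 0 := by
  rw [mcD_apply]; exact mc_derivation_map d c

lemma mcD_C_mul (d : Derivation ℚ K K) (s : K) (hs : d s = 1) (f : PowerSeries K) :
    mcD d (PowerSeries.C s * f) = f + PowerSeries.C s * mcD d f := by
  rw [mcD_apply, mc_derivation_C_mul, hs, map_one, one_mul, mcD_apply]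

lemma TT_eq (d : Derivation ℚ K K) (s : K) (hs : d s = 1) (m : ℕ) (hsm : s - m ≠ 0) :
    Dp K (TT s m) = iot K (tha ^ 2) * (PowerSeries.C s * TT s m + iot K thmu * mc (phi d s) (TT s m)
      - PowerSeries.X ^ m * iot K thy⁻¹) := by
  have h := congrArg (mc (lap s m)) (PDE m)
  rw [mc_add, mc_Dp, mc_natCast_mul, mlap_tau, mc_add] at h
  set Q := mc (lap s m) (PP m) with hQ
  have e1 : beta * (dt (PP m) + m * PP m) = (dt (PP m) + m * PP m)
      - tau (4 * thmu) * (tt * (dt (PP m) + m * PP m))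
      + tau thmu * (tt * (tt * (dt (PP m) + m * PP m))) := by
    rw [beta, map_mul, map_ofNat]; ring
  have e2 : mc (lap s m) (tau thmu * tt * PP m) = - iot K thmu * mcD d Q := by
    rw [mul_assoc, mlap_tau, mlap_tt d s hs m hsm]; ring
  have e3 : mc (lap s m) (dt (PP m) + m * PP m) = PowerSeries.C s * Q - iot K thy⁻¹ := by
    rw [mlap_dt s m hsm, ev0_PP]
  have e4 : mc (lap s m) (tt * (dt (PP m) + m * PP m)) = - mcD d (PowerSeries.C s * Q) := by
    rw [mlap_tt d s hs m hsm, e3, map_sub, mcD_iot, sub_zero]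
  have e5 : mc (lap s m) (tt * (tt * (dt (PP m) + m * PP m)))
      = mcD d (mcD d (PowerSeries.C s * Q)) := by
    rw [mlap_tt d s hs m hsm, e4, map_neg, neg_neg]
  rw [e1, e2, mc_add, mc_sub, mlap_tau, mlap_tau, e3, e4, e5, mcD_C_mul d s hs, map_add] at h
  rw [TT, mc_X_pow_mul, mc_phi, ← hQ, Dp_mul, Dp_X_pow, mcD_C_mul d s hs]
  rw [map_mul, map_ofNat] at h
  linear_combination PowerSeries.X ^ m * h

lemma coeff_mul_low {R : Type*} [CommRing R] (f g : PowerSeries R) (N : ℕ)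
    (hg : ∀ i < N, PowerSeries.coeff i g = 0) :
    PowerSeries.coeff N (f * g) = PowerSeries.constantCoeff f * PowerSeries.coeff N g := by
  rw [PowerSeries.coeff_mul, Finset.sum_eq_single (0, N)]
  · simp
  · intro x hx hne
    rw [Finset.HasAntidiagonal.mem_antidiagonal] at hx
    rw [hg x.2, mul_zero]
    by_contra hlt
    apply hne
    ext <;> simp <;> omega
  · intro h; simp at h

lemma uniq (s : K) (hsm : ∀ m : ℕ, s - m ≠ 0) (φ : K →ₗ[ℚ] K) (G : PowerSeries K)
    (h : Dp K G = iot K (tha ^ 2) * (PowerSeries.C s * G + iot K thmu * mc φ G)) : G = 0 := by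
  have ha : PowerSeries.constantCoeff (iot K (tha ^ 2)) = 1 := by
    rw [← PowerSeries.coeff_zero_eq_constantCoeff_apply, PowerSeries.coeff_map]
    simp [tha_zero]
  have hm : PowerSeries.constantCoeff (iot K thmu) = 0 := by
    rw [← PowerSeries.coeff_zero_eq_constantCoeff_apply, PowerSeries.coeff_map]
    simp [thmu_zero]
  ext N
  rw [map_zero]
  induction N using Nat.strong_induction_on with
  | _ N ih =>
    have l1 : ∀ M ≤ N, PowerSeries.coeff M (iot K thmu * mc φ G) = 0 := by
      intro M hM
      rw [coeff_mul_low, hm, zero_mul]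
      intro i hi
      rw [coeff_mc, ih i (by omega), map_zero]
    have hN := congrArg (PowerSeries.coeff N) h
    rw [coeff_Dp, coeff_mul_low, ha, one_mul, map_add, l1 N le_rfl, PowerSeries.coeff_C_mul,
      add_zero] at hN
    · have : (s - N) * PowerSeries.coeff N G = 0 := by linear_combination -hN
      exact (mul_eq_zero.1 this).resolve_left (hsm N)
    · intro i hi
      rw [map_add, l1 i hi.le, PowerSeries.coeff_C_mul, ih i hi]; simp

/-- `∑ c_k λ^k` with `λ = 4 μ` -/
noncomputable def GG (c : ℕ → K) : PowerSeries K :=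
  psum fun k => PowerSeries.C (c k) * iot K (4 * thmu) ^ k

lemma lam_zero : PowerSeries.constantCoeff (iot K (4 * thmu)) = 0 := by
  rw [← PowerSeries.coeff_zero_eq_constantCoeff_apply, PowerSeries.coeff_map]
  simp [thmu_zero]

lemma GG_good (c : ℕ → K) : Good fun k => PowerSeries.C (c k) * iot K (4 * thmu) ^ k := by
  intro m N h
  rw [PowerSeries.coeff_C_mul, coeff_pow_eq_zero lam_zero m N h, mul_zero]

lemma GG_add (c c' : ℕ → K) : GG (fun k => c k + c' k) = GG c + GG c' := by
  unfold GG
  rw [← psum_add]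
  congr 1; funext k; rw [map_add]; ring

lemma GG_C_mul (x : K) (c : ℕ → K) : GG (fun k => x * c k) = PowerSeries.C x * GG c := by
  unfold GG
  rw [← psum_mul (GG_good c)]
  congr 1; funext k; rw [map_mul]; ring

lemma GG_shift (c : ℕ → K) : GG c = PowerSeries.C (c 0) + iot K (4 * thmu) * GG (fun k => c (k + 1)) := by
  unfold GG
  rw [psum_shift (GG_good c), ← psum_mul (GG_good _)]
  congr 1
  · simp
  · congr 1; funext k; ring

lemma GG_mc (φ : K →ₗ[ℚ] K) (c : ℕ → K) : mc φ (GG c) = GG (fun k => φ (c k)) := by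
  unfold GG
  rw [← psum_mc]
  congr 1; funext k
  ext n
  rw [coeff_mc, PowerSeries.coeff_C_mul, PowerSeries.coeff_C_mul, ← map_pow, PowerSeries.coeff_map,
    mul_comm, ← Algebra.smul_def, map_smul, Algebra.smul_def, mul_comm]

lemma GG_Dp (c : ℕ → K) : Dp K (GG c) = iot K (thy ^ 2) * GG (fun k => k * c k) := by
  unfold GG
  rw [← psum_Dp, ← psum_mul (GG_good _)]
  congr 1; funext k
  have d4 : Dp ℚ (4 : PowerSeries ℚ) = 0 := Derivation.map_natCast _ 4
  have h : Dp K (iot K (4 * thmu)) = iot K (thy ^ 2) * iot K (4 * thmu) := by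
    rw [Dp_map, Dp_mul, d4, Dp_thmu, ← map_mul]; congr 1; ring
  rw [Dp_mul, Dp_C, derivation_pow (Dp K) _ _ h, map_mul PowerSeries.C, map_natCast PowerSeries.C]
  ring

lemma GG_eq (d : Derivation ℚ K K) (s : K) (hsm : ∀ m : ℕ, s - m ≠ 0) (g : ℕ → K)
    (g0 : s * g 0 = 1)
    (hg : ∀ n : ℕ, (s - (n + 1 : ℕ)) * g (n + 1) = - (n * g n) + (-(1/4)) * phi d s (g n)) :
    Dp K (GG g) = iot K (tha ^ 2) * (PowerSeries.C s * GG g + iot K thmu * mc (phi d s) (GG g)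
      - 1) := by
  have h1 : GG (fun k => s * g k + (-1) * (k * g k)) = PowerSeries.C s * GG g
      - GG (fun k => k * g k) := by
    rw [GG_add, GG_C_mul, GG_C_mul]; simp; ring
  have h2 : GG (fun k => s * g k + (-1) * (k * g k))
      = 1 + iot K (4 * thmu) * (- GG (fun k => k * g k)
        - PowerSeries.C (1/4) * mc (phi d s) (GG g)) := by
    rw [GG_shift]
    congr 1
    · simp [g0]
    · congr 1
      rw [GG_mc]
      have : (fun k : ℕ => s * g (k + 1) + (-1) * (((k + 1 : ℕ) : K) * g (k + 1)))
          = fun k : ℕ => (-1) * (k * g k) + (-(1/4)) * phi d s (g k) := by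
        funext k
        linear_combination hg k
      rw [this, GG_add, GG_C_mul, GG_C_mul]
      simp only [map_neg, map_one]; ring
  have h4 : (4 : PowerSeries K) * PowerSeries.C (1/4) = 1 := by
    have h4 : (4 : PowerSeries K) = PowerSeries.C 4 := (map_ofNat PowerSeries.C 4).symm
    have : CharZero K := algebraRat.charZero K
    rw [h4, ← map_mul]; norm_num
  have h5 := congrArg (iot K) thmu_rel
  rw [GG_Dp]
  simp only [map_mul, map_sub, map_pow, map_ofNat] at h2 h5 ⊢
  rw [h1] at h2
  linear_combination (GG fun k => (k : K) * g k) * h5 - iot K tha ^ 2 * h2 + iot K tha ^ 2 * iot K thmu * mc (phi d s) (GG g) * h4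

noncomputable def HH (s : K) : PowerSeries K :=
  psum fun m => iot K (PowerSeries.C (PowerSeries.coeff m thy)) * TT s m

lemma TT_low (s : K) (m N : ℕ) (h : N < m) : PowerSeries.coeff N (TT s m) = 0 := by
  rw [TT, PowerSeries.coeff_X_pow_mul', if_neg (by omega)]

lemma HH_good (s : K) :
    Good fun m => iot K (PowerSeries.C (PowerSeries.coeff m thy)) * TT s m := by
  intro m N h
  rw [coeff_mul_low, TT_low s m N h, mul_zero]
  intro i hi
  exact TT_low s m i (by omega)

lemma HH_eq (d : Derivation ℚ K K) (s : K) (hs : d s = 1) (hsm : ∀ m : ℕ, s - m ≠ 0) :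
    Dp K (HH s) = iot K (tha ^ 2) * (PowerSeries.C s * HH s + iot K thmu * mc (phi d s) (HH s)
      - 1) := by
  have hgd : Good fun m => mc (phi d s)
      (iot K (PowerSeries.C (PowerSeries.coeff m thy)) * TT s m) := by
    intro m N h; rw [coeff_mc, HH_good s m N h, map_zero]
  have hyg : Good fun m => iot K (PowerSeries.C (PowerSeries.coeff m thy)) * PowerSeries.X ^ m := by
    intro m N h
    dsimp only
    rw [PowerSeries.map_C, PowerSeries.coeff_C_mul, PowerSeries.coeff_X_pow, if_neg (by omega), mul_zero]
  have hy : psum (fun m => iot K (PowerSeries.C (PowerSeries.coeff m thy)) * PowerSeries.X ^ m)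
      = iot K thy := by
    ext N
    rw [psum, PowerSeries.coeff_mk, PowerSeries.coeff_map, Finset.sum_eq_single N]
    · simp
    · intro m _ hne
      rw [PowerSeries.map_C, PowerSeries.coeff_C_mul, PowerSeries.coeff_X_pow, if_neg (by omega), mul_zero]
    · intro h; simp at h
  have h1 : iot K thy * iot K thy⁻¹ = 1 := by
    rw [← map_mul, PowerSeries.mul_inv_cancel _ (by rw [thy_zero]; simp), map_one]
  have key : ∀ m, Dp K (iot K (PowerSeries.C (PowerSeries.coeff m thy)) * TT s m)
      = iot K (tha ^ 2) * (PowerSeries.C s) *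
          (iot K (PowerSeries.C (PowerSeries.coeff m thy)) * TT s m)
        + (iot K (tha ^ 2) * iot K thmu * mc (phi d s)
          (iot K (PowerSeries.C (PowerSeries.coeff m thy)) * TT s m)
        + (- iot K (tha ^ 2) * iot K thy⁻¹) *
          (iot K (PowerSeries.C (PowerSeries.coeff m thy)) * PowerSeries.X ^ m)) := by
    intro m
    rw [mc_map_mul, Dp_mul, TT_eq d s hs m (hsm m), PowerSeries.map_C, Dp_C]
    ring
  rw [HH, ← psum_Dp]
  simp only [key]
  rw [psum_add, psum_add, psum_mul (HH_good s), psum_mul hgd, psum_mul hyg, hy, psum_mc]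
  linear_combination -iot K (tha ^ 2) * h1

theorem main_abstract (d : Derivation ℚ K K) (s : K) (hs : d s = 1) (hsm : ∀ m : ℕ, s - m ≠ 0)
    (g : ℕ → K) (g0 : s * g 0 = 1)
    (hg : ∀ n : ℕ, (s - (n + 1 : ℕ)) * g (n + 1) = - (n * g n) + (-(1/4)) * phi d s (g n)) :
    GG g = HH s := by
  rw [← sub_eq_zero]
  apply uniq s hsm (phi d s)
  rw [map_sub, mc_sub, GG_eq d s hsm g g0 hg, HH_eq d s hs hsm]
  ring

lemma lam_pow_coeff (N : ℕ) : PowerSeries.coeff N ((4 * thmu) ^ N) = 16 ^ N := by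
  obtain ⟨w, hw⟩ := PowerSeries.X_dvd_iff.2 thmu_zero
  have h4 : (4 : PowerSeries ℚ) = PowerSeries.C 4 := (map_ofNat PowerSeries.C 4).symm
  have h1 := thmu_one
  have e : (4 * thmu) ^ N = PowerSeries.X ^ N * (4 * w) ^ N := by rw [hw]; ring
  rw [hw, show (1 : ℕ) = 0 + 1 from rfl, PowerSeries.coeff_succ_X_mul, PowerSeries.coeff_zero_eq_constantCoeff_apply] at h1
  rw [e, PowerSeries.coeff_X_pow_mul', if_pos le_rfl, Nat.sub_self,
    PowerSeries.coeff_zero_eq_constantCoeff_apply, map_pow, map_mul, h1, h4]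
  norm_num

theorem main_coeff (d : Derivation ℚ K K) (s : K) (hs : d s = 1) (hsm : ∀ m : ℕ, s - m ≠ 0)
    (g : ℕ → K) (g0 : s * g 0 = 1)
    (hg : ∀ n : ℕ, (s - (n + 1 : ℕ)) * g (n + 1) = - (n * g n) + (-(1/4)) * phi d s (g n))
    (N : ℕ) :
    ∑ k ∈ Finset.range N, PowerSeries.coeff N ((4 * thmu) ^ k) • g k + (16 ^ N : ℚ) • g N
      = ∑ m ∈ Finset.range N, PowerSeries.coeff m thy • lap s m (PowerSeries.coeff (N - m) (PP m))
        + PowerSeries.coeff N thy • (1 / (s - N)) := by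
  have h := congrArg (PowerSeries.coeff N) (main_abstract d s hs hsm g g0 hg)
  rw [GG, HH, psum, psum, PowerSeries.coeff_mk, PowerSeries.coeff_mk] at h
  have e1 : ∀ k, PowerSeries.coeff N (PowerSeries.C (g k) * iot K (4 * thmu) ^ k)
      = PowerSeries.coeff N ((4 * thmu) ^ k) • g k := by
    intro k
    rw [PowerSeries.coeff_C_mul, ← map_pow, PowerSeries.coeff_map, Algebra.smul_def, mul_comm]
  have e2 : ∀ m ∈ Finset.range (N + 1), PowerSeries.coeff N
      (iot K (PowerSeries.C (PowerSeries.coeff m thy)) * TT s m)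
      = PowerSeries.coeff m thy • lap s m (PowerSeries.coeff (N - m) (PP m)) := by
    intro m hm
    rw [Finset.mem_range] at hm
    rw [PowerSeries.map_C, PowerSeries.coeff_C_mul, TT, PowerSeries.coeff_X_pow_mul',
      if_pos (by omega), coeff_mc, Algebra.smul_def]
  simp only [e1] at h
  rw [Finset.sum_congr rfl e2, Finset.sum_range_succ, Finset.sum_range_succ, lam_pow_coeff,
    Nat.sub_self, PP_zero] at h
  rw [h]
  congr 2
  have : (1 : ℚ[X]) = Polynomial.monomial 0 1 := by simp
  rw [this, lap_monomial]; simp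

end laplace

section ratfunc

lemma exists_rep (f : RatFunc ℚ) : ∃ P Q : ℚ[X], Q ≠ 0 ∧
    f = algebraMap ℚ[X] (RatFunc ℚ) P / algebraMap ℚ[X] (RatFunc ℚ) Q :=
  ⟨f.num, f.denom, f.denom_ne_zero, (RatFunc.num_div_denom f).symm⟩

lemma am_ne {Q : ℚ[X]} (h : Q ≠ 0) : algebraMap ℚ[X] (RatFunc ℚ) Q ≠ 0 :=
  RatFunc.algebraMap_ne_zero h

lemma rat_cross (n D P Q : ℚ[X]) (hD : D ≠ 0) (hQ : Q ≠ 0) (h1 : n * Q = P * D) :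
    algebraMap ℚ[X] (RatFunc ℚ) (Polynomial.derivative n * D - n * Polynomial.derivative D)
        / algebraMap ℚ[X] (RatFunc ℚ) (D ^ 2)
      = algebraMap ℚ[X] (RatFunc ℚ) (Polynomial.derivative P * Q - P * Polynomial.derivative Q)
        / algebraMap ℚ[X] (RatFunc ℚ) (Q ^ 2) := by
  have h2 := congrArg Polynomial.derivative h1
  rw [Polynomial.derivative_mul, Polynomial.derivative_mul] at h2
  have h3 : (Polynomial.derivative n * D - n * Polynomial.derivative D) * Q ^ 2
      = (Polynomial.derivative P * Q - P * Polynomial.derivative Q) * D ^ 2 := by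
    linear_combination Q * D * h2
      + (- D * Polynomial.derivative Q - Polynomial.derivative D * Q) * h1
  rw [div_eq_div_iff (am_ne (pow_ne_zero 2 hD)) (am_ne (pow_ne_zero 2 hQ)),
    ← map_mul, ← map_mul, h3]

lemma ratDeriv_div (P Q : ℚ[X]) (hQ : Q ≠ 0) :
    ratDeriv (algebraMap ℚ[X] (RatFunc ℚ) P / algebraMap ℚ[X] (RatFunc ℚ) Q)
      = algebraMap ℚ[X] (RatFunc ℚ) (Polynomial.derivative P * Q - P * Polynomial.derivative Q)
        / algebraMap ℚ[X] (RatFunc ℚ) (Q ^ 2) := by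
  obtain ⟨f, hf⟩ : ∃ f, f = algebraMap ℚ[X] (RatFunc ℚ) P / algebraMap ℚ[X] (RatFunc ℚ) Q := ⟨_, rfl⟩
  rw [← hf, ratDeriv, RatFunc.mk_eq_div]
  have hD := f.denom_ne_zero
  apply rat_cross _ _ _ _ hD hQ
  have h := RatFunc.num_div_denom f
  have h := h.trans hf
  rw [div_eq_div_iff (am_ne hD) (am_ne hQ), ← map_mul, ← map_mul] at h
  exact RatFunc.algebraMap_injective ℚ h

lemma ratDeriv_add (f g : RatFunc ℚ) : ratDeriv (f + g) = ratDeriv f + ratDeriv g := by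
  obtain ⟨P, Q, hQ, rfl⟩ := exists_rep f
  obtain ⟨P', Q', hQ', rfl⟩ := exists_rep g
  have h1 := am_ne hQ
  have h2 := am_ne hQ'
  rw [div_add_div _ _ h1 h2, ← map_mul, ← map_mul, ← map_mul, ← map_add,
    ratDeriv_div _ _ (mul_ne_zero hQ hQ'), ratDeriv_div _ _ hQ, ratDeriv_div _ _ hQ']
  simp only [Polynomial.derivative_mul, Polynomial.derivative_add, map_mul, map_add, map_sub, map_pow]
  field_simp
  ring

lemma ratDeriv_mul (f g : RatFunc ℚ) : ratDeriv (f * g) = f * ratDeriv g + g * ratDeriv f := by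
  obtain ⟨P, Q, hQ, rfl⟩ := exists_rep f
  obtain ⟨P', Q', hQ', rfl⟩ := exists_rep g
  have h1 := am_ne hQ
  have h2 := am_ne hQ'
  rw [div_mul_div_comm, ← map_mul, ← map_mul,
    ratDeriv_div _ _ (mul_ne_zero hQ hQ'), ratDeriv_div _ _ hQ, ratDeriv_div _ _ hQ']
  simp only [Polynomial.derivative_mul, map_mul, map_add, map_sub, map_pow]
  field_simp
  ring

lemma ratDeriv_poly (P : ℚ[X]) : ratDeriv (algebraMap ℚ[X] (RatFunc ℚ) P)
    = algebraMap ℚ[X] (RatFunc ℚ) (Polynomial.derivative P) := by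
  have := ratDeriv_div P 1 one_ne_zero
  simpa using this

lemma rat_am (c : ℚ) : algebraMap ℚ (RatFunc ℚ) c = algebraMap ℚ[X] (RatFunc ℚ) (Polynomial.C c) := by
  rw [RatFunc.algebraMap_C]
  exact congrFun (congrArg DFunLike.coe (Subsingleton.elim (algebraMap ℚ (RatFunc ℚ)) RatFunc.C)) c

lemma rsm (c : ℚ) (f : RatFunc ℚ) : c • f = algebraMap ℚ (RatFunc ℚ) c * f := by
  rw [RatFunc.smul_eq_C_mul, rat_am, RatFunc.algebraMap_C]

noncomputable def Dv : Derivation ℚ (RatFunc ℚ) (RatFunc ℚ) :=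
  Derivation.mk'
    { toFun := ratDeriv
      map_add' := ratDeriv_add
      map_smul' := by
        intro c f
        rw [Algebra.smul_def, ratDeriv_mul, rat_am, ratDeriv_poly, Polynomial.derivative_C, map_zero,
          mul_zero, add_zero, RingHom.id_apply, Algebra.smul_def, rat_am] }
    (by intro a b; exact ratDeriv_mul a b)

lemma Dv_apply (f : RatFunc ℚ) : Dv f = ratDeriv f := rfl

lemma Dv_X : Dv RatFunc.X = 1 := by
  rw [Dv_apply, ← RatFunc.algebraMap_X, ratDeriv_poly]; simp

noncomputable def ds : Derivation ℚ (RatFunc ℚ) (RatFunc ℚ) := (-RatFunc.X ^ 2 : RatFunc ℚ) • Dv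

lemma ds_apply (f : RatFunc ℚ) : ds f = - RatFunc.X ^ 2 * Dv f := rfl

lemma Xne : (RatFunc.X : RatFunc ℚ) ≠ 0 := RatFunc.X_ne_zero

lemma ds_s : ds (RatFunc.X⁻¹) = 1 := by
  have h := congrArg Dv (mul_inv_cancel₀ Xne)
  rw [Derivation.leibniz, Derivation.map_one_eq_zero, Dv_X] at h
  simp only [smul_eq_mul, mul_one] at h
  rw [ds_apply]
  have h2 := mul_inv_cancel₀ Xne
  linear_combination - RatFunc.X * h + h2

lemma phi_ds (x : RatFunc ℚ) : phi ds RatFunc.X⁻¹ x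
    = 4 * (x - RatFunc.X * Dv x) + RatFunc.X ^ 2 * Dv (RatFunc.X * Dv x) := by
  have h2 := mul_inv_cancel₀ Xne
  show 4 * ds (RatFunc.X⁻¹ * x) + ds (RatFunc.X⁻¹ * ds x) = _
  have e : RatFunc.X⁻¹ * ds x = - (RatFunc.X * Dv x) := by
    rw [ds_apply]; linear_combination (- RatFunc.X * Dv x) * h2
  rw [e, Derivation.leibniz, ds_s, smul_eq_mul, smul_eq_mul, e, map_neg, ds_apply]
  ring

lemma s_sub (m : ℕ) : ((RatFunc.X : RatFunc ℚ)⁻¹ - (m : RatFunc ℚ))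
    = algebraMap ℚ[X] (RatFunc ℚ) (1 - (m : ℚ[X]) * X) / algebraMap ℚ[X] (RatFunc ℚ) X := by
  rw [eq_div_iff (am_ne Polynomial.X_ne_zero)]
  simp only [map_sub, map_mul, map_natCast, map_one, RatFunc.algebraMap_X]
  linear_combination mul_inv_cancel₀ Xne

lemma one_sub_ne (m : ℕ) : (1 - (m : ℚ[X]) * X) ≠ 0 := by
  intro h
  have := congrArg (Polynomial.eval 0) h
  simp at this

lemma s_sub_ne (m : ℕ) : ((RatFunc.X : RatFunc ℚ)⁻¹ - (m : RatFunc ℚ)) ≠ 0 := by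
  rw [s_sub]
  exact div_ne_zero (am_ne (one_sub_ne m)) (am_ne Polynomial.X_ne_zero)

/-- regularity at the point `x` -/
def Reg (x : ℚ) (f : RatFunc ℚ) : Prop := ∃ P Q : ℚ[X], Q.eval x ≠ 0 ∧
    f = algebraMap ℚ[X] (RatFunc ℚ) P / algebraMap ℚ[X] (RatFunc ℚ) Q

lemma ne_of_eval {x : ℚ} {Q : ℚ[X]} (h : Q.eval x ≠ 0) : Q ≠ 0 := by
  rintro rfl; simp at h

lemma Reg.add {x : ℚ} {f g : RatFunc ℚ} (hf : Reg x f) (hg : Reg x g) : Reg x (f + g) := by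
  obtain ⟨P, Q, hQ, rfl⟩ := hf
  obtain ⟨P', Q', hQ', rfl⟩ := hg
  refine ⟨P * Q' + Q * P', Q * Q', by rw [Polynomial.eval_mul]; exact mul_ne_zero hQ hQ', ?_⟩
  rw [div_add_div _ _ (am_ne (ne_of_eval hQ)) (am_ne (ne_of_eval hQ'))]
  simp only [map_mul, map_add]

lemma Reg.mul {x : ℚ} {f g : RatFunc ℚ} (hf : Reg x f) (hg : Reg x g) : Reg x (f * g) := by
  obtain ⟨P, Q, hQ, rfl⟩ := hf
  obtain ⟨P', Q', hQ', rfl⟩ := hg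
  refine ⟨P * P', Q * Q', by rw [Polynomial.eval_mul]; exact mul_ne_zero hQ hQ', ?_⟩
  rw [div_mul_div_comm, map_mul, map_mul]

lemma Reg.poly (x : ℚ) (P : ℚ[X]) : Reg x (algebraMap ℚ[X] (RatFunc ℚ) P) :=
  ⟨P, 1, by simp, by simp⟩

lemma Reg.smul {x : ℚ} {f : RatFunc ℚ} (c : ℚ) (hf : Reg x f) : Reg x (algebraMap ℚ (RatFunc ℚ) c * f) := by
  rw [rat_am]
  exact (Reg.poly x _).mul hf

lemma Reg.sum {x : ℚ} {ι : Type*} (t : Finset ι) (f : ι → RatFunc ℚ) (h : ∀ i ∈ t, Reg x (f i)) :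
    Reg x (∑ i ∈ t, f i) := by
  classical
  induction t using Finset.induction_on with
  | empty => simpa using Reg.poly x 0
  | insert a t ha ih =>
    rw [Finset.sum_insert ha]
    exact (h a (Finset.mem_insert_self _ _)).add (ih fun i hi => h i (Finset.mem_insert_of_mem hi))

lemma reg_iff (x : ℚ) (f : RatFunc ℚ) : Reg x f ↔ f.denom.eval x ≠ 0 := by
  constructor
  · rintro ⟨P, Q, hQ, rfl⟩ h
    obtain ⟨w, hw⟩ := RatFunc.denom_div_dvd P Q
    apply hQ
    rw [hw, Polynomial.eval_mul, h, zero_mul]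
  · intro h
    exact ⟨f.num, f.denom, h, (RatFunc.num_div_denom f).symm⟩

lemma reg_inv_s (n m : ℕ) (hn : 1 ≤ n) (hm : m ≠ n) :
    Reg (1 / n) (1 / ((RatFunc.X : RatFunc ℚ)⁻¹ - (m : RatFunc ℚ))) := by
  refine ⟨X, 1 - (m : ℚ[X]) * X, ?_, ?_⟩
  · have : (n : ℚ) ≠ 0 := by positivity
    simp only [Polynomial.eval_sub, Polynomial.eval_one, Polynomial.eval_mul, Polynomial.eval_X,
      Polynomial.eval_natCast]
    intro h
    apply hm
    field_simp at h
    have : (m : ℚ) = n := by linarith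
    exact_mod_cast this
  · rw [s_sub, one_div_div]

lemma not_reg_inv_s (n : ℕ) (hn : 1 ≤ n) :
    ¬ Reg (1 / n) (1 / ((RatFunc.X : RatFunc ℚ)⁻¹ - (n : RatFunc ℚ))) := by
  rintro ⟨P, Q, hQ, h⟩
  have hn0 : (n : ℚ) ≠ 0 := by positivity
  rw [s_sub, one_div_div, div_eq_div_iff (am_ne (one_sub_ne n)) (am_ne (ne_of_eval hQ)),
    ← map_mul, ← map_mul] at h
  have h2 := congrArg (Polynomial.eval (1 / (n : ℚ))) (RatFunc.algebraMap_injective ℚ h)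
  simp only [Polynomial.eval_sub, Polynomial.eval_one, Polynomial.eval_mul, Polynomial.eval_X,
      Polynomial.eval_natCast] at h2
  rw [mul_one_div_cancel hn0, sub_self, mul_zero] at h2
  exact (mul_ne_zero (one_div_ne_zero hn0) hQ) h2

lemma Reg.pow {x : ℚ} {f : RatFunc ℚ} (hf : Reg x f) (k : ℕ) : Reg x (f ^ k) := by
  induction k with
  | zero => simpa using Reg.poly x 1
  | succ k ih => rw [pow_succ]; exact ih.mul hf

lemma reg_lap (n m : ℕ) (hn : 1 ≤ n) (hm : m ≠ n) (P : ℚ[X]) :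
    Reg (1 / n) (lap (RatFunc.X⁻¹ : RatFunc ℚ) m P) := by
  induction P using Polynomial.induction_on' with
  | add p q hp hq => rw [map_add]; exact hp.add hq
  | monomial k c =>
    rw [lap_monomial, Algebra.smul_def]
    apply Reg.smul
    rw [div_eq_mul_one_div (k.factorial : RatFunc ℚ), ← one_div_pow]
    refine Reg.mul ?_ ((reg_inv_s n m hn hm).pow _)
    rw [← map_natCast (algebraMap ℚ[X] (RatFunc ℚ))]
    exact Reg.poly _ _

lemma reg_X (x : ℚ) : Reg x RatFunc.X := by
  rw [← RatFunc.algebraMap_X]; exact Reg.poly _ _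

lemma reg_X_inv (x : ℚ) (hx : x ≠ 0) : Reg x RatFunc.X⁻¹ :=
  ⟨1, X, by simpa using hx, by simp⟩

lemma reg_smul_cancel {x c : ℚ} (hc : c ≠ 0) {f : RatFunc ℚ} (h : Reg x (algebraMap ℚ (RatFunc ℚ) c * f)) : Reg x f := by
  have h2 := h.smul c⁻¹
  rwa [← mul_assoc, ← map_mul, inv_mul_cancel₀ hc, map_one, one_mul] at h2

lemma reg_add_cancel {x : ℚ} {f g : RatFunc ℚ} (hf : Reg x f) (h : Reg x (f + g)) : Reg x g := by
  have h2 := h.add (hf.smul (-1))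
  have e : f + g + algebraMap ℚ (RatFunc ℚ) (-1) * f = g := by rw [map_neg, map_one]; ring
  rwa [e] at h2

lemma coeff_thy_ne (n : ℕ) : PowerSeries.coeff n thy ≠ 0 ↔ ∃ a b : ℤ, (n : ℤ) = a ^ 2 + b ^ 2 := by
  rw [coeff_thy]
  have hs : sg n ≠ 0 := by unfold sg; split_ifs <;> norm_num
  rw [mul_ne_zero_iff, and_iff_right hs, Nat.cast_ne_zero, Finset.card_ne_zero]
  constructor
  · rintro ⟨x, hx⟩
    exact ⟨x.1, x.2, ((mem_circ n x).1 hx).symm⟩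
  · rintro ⟨a, b, hab⟩
    exact ⟨(a, b), (mem_circ n _).2 hab.symm⟩

end ratfunc

/-- For every `n ≥ 1`, the rational function `h n` has a pole at `v = 1/n`
(i.e. the denominator of its reduced form vanishes at `1/n`)
if and only if `n` is a sum of two squares of integers. -/
theorem h_pole_iff_sum_two_squares
    (h : ℕ → RatFunc ℚ)
    (h0 : h 0 = 1)
    (hrec : ∀ n : ℕ, 1 ≤ n →
      h n / RatFunc.X - (n : ℚ) • h n + ((n : ℚ) - 1) • h (n - 1)
        - RatFunc.X * ratDeriv (h (n - 1))
        + (1/4 : ℚ) •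
          (RatFunc.X * ratDeriv (RatFunc.X * ratDeriv (RatFunc.X * h (n - 1)))) = 0)
    (n : ℕ) (hn : 1 ≤ n) :
    (h n).denom.eval ((1 : ℚ) / n) = 0 ↔ ∃ a b : ℤ, (n : ℤ) = a ^ 2 + b ^ 2 := by
  have hX := mul_inv_cancel₀ Xne
  have g0 : RatFunc.X⁻¹ * (RatFunc.X * h 0) = 1 := by
    rw [h0]; linear_combination hX
  have hg : ∀ k : ℕ, ((RatFunc.X : RatFunc ℚ)⁻¹ - ((k + 1 : ℕ) : RatFunc ℚ)) * (RatFunc.X * h (k + 1))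
      = - ((k : RatFunc ℚ) * (RatFunc.X * h k)) + (-(1/4)) * phi ds RatFunc.X⁻¹ (RatFunc.X * h k) := by
    intro k
    have hk := hrec (k + 1) (by omega)
    rw [Nat.add_sub_cancel] at hk
    have hc : ((k + 1 : ℕ) : ℚ) - 1 = k := by push_cast; ring
    have hl : Dv (RatFunc.X * h k) = RatFunc.X * Dv (h k) + h k := by
      rw [Derivation.leibniz, Dv_X, smul_eq_mul, smul_eq_mul, mul_one]
    rw [hc, rsm, rsm, rsm] at hk
    simp only [map_natCast, ← Dv_apply] at hk
    have h4 : algebraMap ℚ (RatFunc ℚ) (1/4) = 1/4 := by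
      rw [map_div₀, map_one, map_ofNat]
    rw [h4, div_eq_mul_inv] at hk
    rw [phi_ds]
    linear_combination RatFunc.X * hk - RatFunc.X * hl
  have key := fun N => main_coeff ds RatFunc.X⁻¹ ds_s s_sub_ne (fun k => RatFunc.X * h k) g0 hg N
  simp only [Algebra.smul_def] at key
  have hR : ∀ N, N ≤ n → (∀ k < N, Reg (1 / n) (RatFunc.X * h k)) →
      Reg (1 / n) (∑ m ∈ Finset.range N, algebraMap ℚ (RatFunc ℚ) (PowerSeries.coeff m thy) *
        lap (RatFunc.X⁻¹ : RatFunc ℚ) m (PowerSeries.coeff (N - m) (PP m))) ∧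
      Reg (1 / n) (∑ k ∈ Finset.range N, algebraMap ℚ (RatFunc ℚ) (PowerSeries.coeff N ((4 * thmu) ^ k)) *
        (RatFunc.X * h k)) := by
    intro N hN ih
    constructor
    · apply Reg.sum
      intro m hm
      rw [Finset.mem_range] at hm
      exact (reg_lap n m hn (by omega) _).smul _
    · apply Reg.sum
      intro m hm
      rw [Finset.mem_range] at hm
      exact (ih m hm).smul _
  have low : ∀ N, N < n → Reg (1 / n) (RatFunc.X * h N) := by
    intro N
    induction N using Nat.strong_induction_on with
    | _ N ih =>
      intro hN
      obtain ⟨r1, r2⟩ := hR N hN.le fun k hk => ih k hk (by omega)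
      have hk := key N
      apply reg_smul_cancel (c := 16 ^ N) (by positivity)
      apply reg_add_cancel r2
      rw [hk]
      exact r1.add ((reg_inv_s n N hn (by omega)).smul _)
  obtain ⟨r1, r2⟩ := hR n le_rfl low
  have hk := key n
  have hn0 : (1 / n : ℚ) ≠ 0 := by positivity
  rw [← coeff_thy_ne, ← not_iff_not, not_not, ← ne_eq, ← reg_iff]
  constructor
  · intro hreg
    by_contra hc
    apply not_reg_inv_s n hn
    apply reg_smul_cancel hc
    apply reg_add_cancel r1
    rw [← hk]
    exact r2.add (((reg_X _).mul hreg).smul _)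
  · intro hc
    have : Reg (1 / n) (RatFunc.X * h n) := by
      apply reg_smul_cancel (c := 16 ^ n) (by positivity)
      apply reg_add_cancel r2
      rw [hk, hc, map_zero, zero_mul, add_zero]
      exact r1
    have h2 := (reg_X_inv (1 / n) hn0).mul this
    have e : RatFunc.X⁻¹ * (RatFunc.X * h n) = h n := by linear_combination h n * hX
    rwa [e] at h2
end
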